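/- Overlap concentration for matrix factorization: In the perturbed bipartite model with s_n = n^{−1/4}, the overlaps concentrate: ∫₁²∫₁² E⟨(u⁽¹⁾·u⁽²⁾ − E⟨u⁽¹⁾·u⁽²⁾⟩_n)²⟩_n da_u da_v → 0 and ∫₁²∫₁² E⟨(v⁽¹⁾·v⁽²⁾ − E⟨v⁽¹⁾·v⁽²⁾⟩_n)²⟩_n da_u da_v → 0 as n → ∞, where (u⁽¹⁾,v⁽¹⁾) and (u⁽²⁾,v⁽²⁾) are independent replicas from ⟨·⟩_n. -/

import Mathlib

open MeasureTheory ProbabilityTheory Filter Real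
open scoped Topology

noncomputable section

/-- Standard Gaussian measure on `ℝ`. -/
def stdG : Measure ℝ := gaussianReal 0 1

/-- The weight `exp(√γ·x·z + γ·x·x₀ − γ·x²/2)` appearing in the scalar Gaussian channel. -/
def scalarWeight (γ x₀ z x : ℝ) : ℝ :=
  Real.exp (Real.sqrt γ * x * z + γ * x * x₀ - γ * x ^ 2 / 2)

/-- Free energy `ψ_P(γ)` of the scalar Gaussian channel with prior `P`. -/
def psiF (P : Measure ℝ) [IsProbabilityMeasure P] (γ : ℝ) : ℝ :=
  ∫ p : ℝ × ℝ, Real.log (∫ x, scalarWeight γ p.1 p.2 x ∂P) ∂(P.prod stdG)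

/-- Posterior mean `⟨x⟩_γ` in the scalar Gaussian channel (`x₀` is the signal, `z` the noise). -/
def postMean (P : Measure ℝ) (γ x₀ z : ℝ) : ℝ :=
  (∫ x, x * scalarWeight γ x₀ z x ∂P) / (∫ x, scalarWeight γ x₀ z x ∂P)

/-- Overlap `F_P(γ) = E[X₀·⟨x⟩_γ]` of the scalar Gaussian channel. -/
def Fov (P : Measure ℝ) [IsProbabilityMeasure P] (γ : ℝ) : ℝ :=
  ∫ p : ℝ × ℝ, p.1 * postMean P γ p.1 p.2 ∂(P.prod stdG)

/-- The set `Γ(λ)` of fixed points of the state evolution equations. -/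
def Gam (PU PV : Measure ℝ) [IsProbabilityMeasure PU] [IsProbabilityMeasure PV]
    (lam : ℝ) : Set (ℝ × ℝ) :=
  {q | 0 ≤ q.1 ∧ 0 ≤ q.2 ∧ q.2 = Fov PU (lam * q.1) ∧ q.1 = Fov PV (lam * q.2)}

/-- The replica-symmetric potential `𝓕(λ,q₁,q₂)`. -/
def rsF (PU PV : Measure ℝ) [IsProbabilityMeasure PU] [IsProbabilityMeasure PV]
    (lam q₁ q₂ : ℝ) : ℝ :=
  psiF PU (lam * q₁) + psiF PV (lam * q₂) - lam / 2 * q₁ * q₂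

/-- Prior distribution of the pair of vectors `(u,v)`. -/
def prior (PU PV : Measure ℝ) [IsProbabilityMeasure PU] [IsProbabilityMeasure PV]
    (n : ℕ) : Measure ((Fin n → ℝ) × (Fin n → ℝ)) :=
  (Measure.pi fun _ => PU).prod (Measure.pi fun _ => PV)

/-- Law of the Gaussian noise matrix `Z`. -/
def noiseM (n : ℕ) : Measure (Fin n → Fin n → ℝ) :=
  Measure.pi fun _ => Measure.pi fun _ => stdG

/-- Joint law of `((U,V),Z)`. -/
def sampleM (PU PV : Measure ℝ) [IsProbabilityMeasure PU] [IsProbabilityMeasure PV]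
    (n : ℕ) : Measure (((Fin n → ℝ) × (Fin n → ℝ)) × (Fin n → Fin n → ℝ)) :=
  (prior PU PV n).prod (noiseM n)

/-- Hamiltonian `H_n(u,v)` of the planted bipartite model. -/
def Ham (lam : ℝ) (n : ℕ) (U V : Fin n → ℝ) (Z : Fin n → Fin n → ℝ)
    (u v : Fin n → ℝ) : ℝ :=
  ∑ i : Fin n, ∑ j : Fin n,
    (Real.sqrt (lam / n) * u i * v j * Z i j
      + lam / n * (u i * U i * v j * V j)
      - lam / (2 * n) * (u i ^ 2 * v j ^ 2))

/-- Partition function `Z_n = ∫ e^{H_n(u,v)} dP₀ⁿ(u,v)`. -/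
def partFun (PU PV : Measure ℝ) [IsProbabilityMeasure PU] [IsProbabilityMeasure PV]
    (lam : ℝ) (n : ℕ)
    (ω : ((Fin n → ℝ) × (Fin n → ℝ)) × (Fin n → Fin n → ℝ)) : ℝ :=
  ∫ uv, Real.exp (Ham lam n ω.1.1 ω.1.2 ω.2 uv.1 uv.2) ∂(prior PU PV n)

/-- Free energy `F_n(λ) = (1/n)·E[log Z_n]`. -/
def freeEnergy (PU PV : Measure ℝ) [IsProbabilityMeasure PU] [IsProbabilityMeasure PV]
    (n : ℕ) (lam : ℝ) : ℝ :=
  (1 / (n : ℝ)) * ∫ ω, Real.log (partFun PU PV lam n ω) ∂(sampleM PU PV n)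

/-- Gibbs (posterior) expectation `⟨f(u,v)⟩` given the realization `ω = ((U,V),Z)`. -/
def gibbs (PU PV : Measure ℝ) [IsProbabilityMeasure PU] [IsProbabilityMeasure PV]
    (lam : ℝ) (n : ℕ)
    (ω : ((Fin n → ℝ) × (Fin n → ℝ)) × (Fin n → Fin n → ℝ))
    (f : (Fin n → ℝ) × (Fin n → ℝ) → ℝ) : ℝ :=
  (∫ uv, f uv * Real.exp (Ham lam n ω.1.1 ω.1.2 ω.2 uv.1 uv.2) ∂(prior PU PV n))
    / partFun PU PV lam n ω

/-- Rescaled scalar product `x·y = (1/n)·Σᵢ xᵢyᵢ`. -/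
def ovDot (n : ℕ) (x y : Fin n → ℝ) : ℝ := (1 / (n : ℝ)) * ∑ i, x i * y i

/-- Law of a vector of `n` i.i.d. standard Gaussians. -/
def gvec (n : ℕ) : Measure (Fin n → ℝ) := Measure.pi fun _ => stdG

/-- Joint law of `((U,V), Z, ((Z^u,Z^v),(z^u,z^v)))`: signal, noise matrix and the four
extra Gaussian vectors of the side channels and of the perturbation. -/
def sampleP (PU PV : Measure ℝ) [IsProbabilityMeasure PU] [IsProbabilityMeasure PV]
    (n : ℕ) :
    Measure ((((Fin n → ℝ) × (Fin n → ℝ)) × (Fin n → Fin n → ℝ)) ×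
      (((Fin n → ℝ) × (Fin n → ℝ)) × ((Fin n → ℝ) × (Fin n → ℝ)))) :=
  (sampleM PU PV n).prod (((gvec n).prod (gvec n)).prod ((gvec n).prod (gvec n)))

/-- The perturbation strength `s_n = n^{-1/4}`. -/
def sSeq (n : ℕ) : ℝ := (n : ℝ) ^ (-(1 / 4 : ℝ))

/-- Total Hamiltonian `H_n^{(tot)} = H_n + H_n^{(s)} + H_n^{(pert)}`, where
`ω = (((U,V),Z), ((Z^u,Z^v),(z^u,z^v)))`. -/
def HamTot (lam qu qv : ℝ) (n : ℕ) (au av : ℝ)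
    (ω : (((Fin n → ℝ) × (Fin n → ℝ)) × (Fin n → Fin n → ℝ)) ×
      (((Fin n → ℝ) × (Fin n → ℝ)) × ((Fin n → ℝ) × (Fin n → ℝ))))
    (u v : Fin n → ℝ) : ℝ :=
  Ham lam n ω.1.1.1 ω.1.1.2 ω.1.2 u v
  + (∑ i : Fin n,
      (Real.sqrt (lam * qu) * u i * ω.2.1.1 i + lam * qu * u i * ω.1.1.1 i
          - lam * qu / 2 * u i ^ 2
        + Real.sqrt (lam * qv) * v i * ω.2.1.2 i + lam * qv * v i * ω.1.1.2 i
          - lam * qv / 2 * v i ^ 2))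
  + (∑ i : Fin n,
      (Real.sqrt (sSeq n) * au * ω.2.2.1 i * u i + sSeq n * au ^ 2 * u i * ω.1.1.1 i
        - sSeq n * au ^ 2 / 2 * u i ^ 2))
  + (∑ i : Fin n,
      (Real.sqrt (sSeq n) * av * ω.2.2.2 i * v i + sSeq n * av ^ 2 * v i * ω.1.1.2 i
        - sSeq n * av ^ 2 / 2 * v i ^ 2))

/-- Gibbs expectation `⟨f(u,v)⟩_n` for the total Hamiltonian. -/
def gibbsTot (PU PV : Measure ℝ) [IsProbabilityMeasure PU] [IsProbabilityMeasure PV]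
    (lam qu qv : ℝ) (n : ℕ) (au av : ℝ)
    (ω : (((Fin n → ℝ) × (Fin n → ℝ)) × (Fin n → Fin n → ℝ)) ×
      (((Fin n → ℝ) × (Fin n → ℝ)) × ((Fin n → ℝ) × (Fin n → ℝ))))
    (f : (Fin n → ℝ) × (Fin n → ℝ) → ℝ) : ℝ :=
  (∫ uv, f uv * Real.exp (HamTot lam qu qv n au av ω uv.1 uv.2) ∂(prior PU PV n))
    / ∫ uv, Real.exp (HamTot lam qu qv n au av ω uv.1 uv.2) ∂(prior PU PV n)

/-- `E⟨u⁽¹⁾·u⁽²⁾⟩_n`. -/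
def EovU (PU PV : Measure ℝ) [IsProbabilityMeasure PU] [IsProbabilityMeasure PV]
    (lam qu qv : ℝ) (n : ℕ) (au av : ℝ) : ℝ :=
  ∫ ω, gibbsTot PU PV lam qu qv n au av ω
      (fun uv1 => gibbsTot PU PV lam qu qv n au av ω
        (fun uv2 => ovDot n uv1.1 uv2.1)) ∂(sampleP PU PV n)

/-- `E⟨v⁽¹⁾·v⁽²⁾⟩_n`. -/
def EovV (PU PV : Measure ℝ) [IsProbabilityMeasure PU] [IsProbabilityMeasure PV]
    (lam qu qv : ℝ) (n : ℕ) (au av : ℝ) : ℝ :=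
  ∫ ω, gibbsTot PU PV lam qu qv n au av ω
      (fun uv1 => gibbsTot PU PV lam qu qv n au av ω
        (fun uv2 => ovDot n uv1.2 uv2.2)) ∂(sampleP PU PV n)



/-- A coordinatewise Lipschitz function has at most linear growth. -/
theorem coordLip_bound {ι : Type*} [Fintype ι] [DecidableEq ι] (f : (ι → ℝ) → ℝ) (c : ι → ℝ)
    (hf : ∀ x i y, |f (Function.update x i y) - f x| ≤ c i * |y - x i|) (x y : ι → ℝ) :
    |f x - f y| ≤ ∑ i, c i * |x i - y i| := by
  have key : ∀ s : Finset ι, |f (fun i => if i ∈ s then x i else y i) - f y|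
      ≤ ∑ i ∈ s, c i * |x i - y i| := by
    intro s
    induction s using Finset.induction_on with
    | empty => simp
    | insert a s ha ih =>
      rw [Finset.sum_insert ha]
      have h1 : (fun i => if i ∈ insert a s then x i else y i)
          = Function.update (fun i => if i ∈ s then x i else y i) a (x a) := by
        ext i
        by_cases h : i = a
        · subst h; simp
        · simp [h]
      rw [h1]
      have h2 := hf (fun i => if i ∈ s then x i else y i) a (x a)
      simp only [ha, if_false] at h2
      have := abs_add_le (f (Function.update (fun i => if i ∈ s then x i else y i) a (x a)) -
        f (fun i => if i ∈ s then x i else y i)) (f (fun i => if i ∈ s then x i else y i) - f y)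
      rw [sub_add_sub_cancel] at this
      linarith
  simpa using key Finset.univ

theorem coordLip_memLp {ι : Type*} [Fintype ι] [DecidableEq ι] (μ : ι → Measure ℝ)
    [∀ i, IsProbabilityMeasure (μ i)] (hμ : ∀ i, MemLp (fun x : ℝ => x) 2 (μ i))
    (f : (ι → ℝ) → ℝ) (hm : Measurable f) (c : ι → ℝ)
    (hf : ∀ x i y, |f (Function.update x i y) - f x| ≤ c i * |y - x i|) :
    MemLp f 2 (Measure.pi μ) := by
  have h1 : MemLp (fun x : ι → ℝ => |f 0| + ∑ i, c i * |x i|) 2 (Measure.pi μ) := by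
    refine MemLp.add (memLp_const _) ?_
    refine memLp_finsetSum _ fun i _ => ?_
    refine MemLp.const_mul ?_ _
    have := (hμ i).comp_measurePreserving (measurePreserving_eval μ i)
    exact this.abs
  refine h1.mono hm.aestronglyMeasurable (ae_of_all _ fun x => ?_)
  have := coordLip_bound f c hf x 0
  have h3 := abs_sub_abs_le_abs_sub (f x) (f 0)
  simp only [Pi.zero_apply, sub_zero] at this
  rw [Real.norm_eq_abs, Real.norm_eq_abs]
  exact le_trans (by linarith) (le_abs_self _)

theorem var_le_of_lip (ν : Measure ℝ) [IsProbabilityMeasure ν] (hν : MemLp (fun x : ℝ => x) 2 ν)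
    (g : ℝ → ℝ) (hg : MemLp g 2 ν) (c : ℝ) (h : ∀ x, |g x - g 0| ≤ c * |x|) (k : ℝ) :
    ∫ x, (g x - k) ^ 2 ∂ν ≤ c ^ 2 * ∫ x, x ^ 2 ∂ν + (∫ x, g x ∂ν - k) ^ 2 := by
  have hgi := hg.integrable (by norm_num)
  have hg2 := hg.integrable_sq
  have e1 : ∀ k : ℝ, ∫ x, (g x - k) ^ 2 ∂ν = ∫ x, (g x)^2 ∂ν - 2 * k * ∫ x, g x ∂ν + k ^ 2 := by
    intro k
    have : ∀ x, (g x - k) ^ 2 = (g x)^2 - 2 * k * g x + k ^ 2 := fun x => by ring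
    simp_rw [this]
    have h1 : Integrable (fun x => (g x)^2 - 2 * k * g x) ν := hg2.sub (hgi.const_mul _)
    rw [integral_add h1 (integrable_const _), integral_sub hg2 (hgi.const_mul _),
      integral_const_mul]
    simp
  have e2 : ∫ x, (g x - g 0) ^ 2 ∂ν ≤ c ^ 2 * ∫ x, x ^ 2 ∂ν := by
    rw [← integral_const_mul]
    refine integral_mono ?_ (hν.integrable_sq.const_mul _) fun x => ?_
    · exact (hg.sub (memLp_const (g 0))).integrable_sq
    · have := h x
      have h2 := pow_le_pow_left₀ (abs_nonneg _) this 2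
      simpa [mul_pow, sq_abs] using h2
  rw [e1] at e2 ⊢
  nlinarith [sq_nonneg (∫ x, g x ∂ν - g 0)]

theorem mp_cons (n : ℕ) (μ : Fin (n + 1) → Measure ℝ) [∀ i, IsProbabilityMeasure (μ i)] :
    MeasurePreserving (fun p : ℝ × (Fin n → ℝ) => (Fin.cons p.1 p.2 : Fin (n + 1) → ℝ))
      ((μ 0).prod (Measure.pi fun j : Fin n => μ j.succ)) (Measure.pi μ) := by
  have mp := (measurePreserving_piFinSuccAbove μ 0).symm
  convert mp using 1
  · ext p i
    simp [MeasurableEquiv.piFinSuccAbove, Fin.insertNthEquiv, Fin.insertNth_zero']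
  · simp

/-- The statement proved by induction on the number of coordinates. -/
def ESProp (n : ℕ) : Prop := ∀ (μ : Fin n → Measure ℝ)
    (_ : ∀ i, IsProbabilityMeasure (μ i)) (_ : ∀ i, MemLp (fun x : ℝ => x) 2 (μ i))
    (f : (Fin n → ℝ) → ℝ) (_ : Measurable f) (c : Fin n → ℝ)
    (_ : ∀ x i y, |f (Function.update x i y) - f x| ≤ c i * |y - x i|),
    ∫ x, (f x - ∫ y, f y ∂(Measure.pi μ)) ^ 2 ∂(Measure.pi μ)
      ≤ ∑ i, c i ^ 2 * ∫ x, x ^ 2 ∂(μ i)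

theorem efronStein_step (n : ℕ) (IH : ESProp n) : ESProp (n + 1) := by
    intro μ inst hμ f hm c hf
    have hL := coordLip_memLp μ hμ f hm c hf
    set E := ∫ y, f y ∂(Measure.pi μ) with hE
    let π' := Measure.pi (fun j : Fin n => μ (Fin.succ j))
    obtain ⟨e, he, mp⟩ : ∃ e : ℝ × (Fin n → ℝ) → (Fin (n + 1) → ℝ),
      (∀ p, e p = Fin.cons p.1 p.2) ∧ MeasurePreserving e
      ((μ 0).prod (Measure.pi fun j : Fin n => μ j.succ)) (Measure.pi μ) :=
      ⟨_, fun _ => rfl, mp_cons n μ⟩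
    have hem : Measurable e := mp.measurable
    have hic : ∀ F : (Fin (n + 1) → ℝ) → ℝ, Measurable F → ∫ p, F (e p) ∂((μ 0).prod π')
        = ∫ x, F x ∂(Measure.pi μ) := by
      intro F hF
      rw [← mp.map_eq, integral_map hem.aemeasurable hF.aestronglyMeasurable]
    have hLp : MemLp (fun p : ℝ × (Fin n → ℝ) => f (e p)) 2 ((μ 0).prod π') :=
      hL.comp_measurePreserving mp
    have hcons : Measurable (fun p : ℝ × (Fin n → ℝ) => f (e p)) := hm.comp hem
    let g : (Fin n → ℝ) → ℝ := fun y => ∫ x, f (e (x, y)) ∂(μ 0)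
    have hslice : ∀ y, MemLp (fun x => f (e (x, y))) 2 (μ 0) := by
      intro y
      have hb0 : MemLp (fun x : ℝ => |x|) 2 (μ 0) := (hμ 0).abs
      have hb1 : MemLp (fun x : ℝ => c 0 * |x|) 2 (μ 0) := hb0.const_mul (c 0)
      have hb2 : MemLp (fun _ : ℝ => |f (e (0, y))|) 2 (μ 0) := memLp_const _
      have hb : MemLp (fun x : ℝ => |f (e (0, y))| + c 0 * |x|) 2 (μ 0) := hb2.add hb1
      refine hb.mono (hcons.comp measurable_prodMk_right).aestronglyMeasurable
        (ae_of_all _ fun x => ?_)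
      have := hf (e (0, y)) 0 x
      rw [he] at this
      rw [Fin.update_cons_zero] at this
      simp only [Fin.cons_zero, sub_zero] at this
      simp only [he] at this ⊢
      have h3 := abs_sub_abs_le_abs_sub (f (Fin.cons x y)) (f (Fin.cons 0 y))
      rw [Real.norm_eq_abs, Real.norm_eq_abs]
      exact le_trans (by linarith) (le_abs_self _)
    have hgm : Measurable g := by
      have : StronglyMeasurable g := by
        refine StronglyMeasurable.integral_prod_left' (f := fun p => f (e p)) (μ := μ 0) ?_
        exact hcons.stronglyMeasurable
      exact this.measurable
    have hglip : ∀ x i y, |g (Function.update x i y) - g x| ≤ c (Fin.succ i) * |y - x i| := by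
      intro x i y
      simp only [g]
      rw [← integral_sub ((hslice _).integrable (by norm_num)) ((hslice _).integrable (by norm_num))]
      refine (abs_integral_le_integral_abs).trans ?_
      have : ∀ t, |f (e (t, Function.update x i y)) - f (e (t, x))| ≤ c (Fin.succ i) * |y - x i| := by
        intro t
        have := hf (e (t, x)) (Fin.succ i) y
        rw [he, ← Fin.cons_update] at this
        simpa [he] using this
      refine (integral_mono ?_ (integrable_const _) this).trans (by simp)
      exact (((hslice _).sub (hslice _)).integrable (by norm_num)).abs
    have hInt : Integrable (fun p : ℝ × (Fin n → ℝ) => f (e p)) ((μ 0).prod π') :=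
      hLp.integrable (by norm_num)
    have hEg : E = ∫ y, g y ∂π' := by
      rw [hE, ← hic f hm, integral_prod_symm _ hInt]
    have ih := IH (fun j => μ (Fin.succ j)) (fun j => inst _) (fun j => hμ _) g hgm
      (fun i => c (Fin.succ i)) hglip
    rw [← hic (fun x => (f x - E) ^ 2) (by fun_prop)]
    have hInt2 : Integrable (fun p : ℝ × (Fin n → ℝ) => (f (e p) - E) ^ 2) ((μ 0).prod π') :=
      (hLp.sub (memLp_const E)).integrable_sq
    have hgL := coordLip_memLp (fun j => μ (Fin.succ j)) (fun j => hμ _) g hgm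
      (fun i => c (Fin.succ i)) hglip
    have step : ∫ p, (f (e p) - E) ^ 2 ∂((μ 0).prod π')
        ≤ ∫ y, (c 0 ^ 2 * ∫ x, x ^ 2 ∂(μ 0) + (g y - E) ^ 2) ∂π' := by
      rw [integral_prod_symm _ hInt2]
      refine integral_mono hInt2.integral_prod_right ?_ fun y => ?_
      · exact (integrable_const _).add (hgL.sub (memLp_const E)).integrable_sq
      · refine var_le_of_lip (μ 0) (hμ 0) (fun x => f (e (x, y))) (hslice y) (c 0) (fun x => ?_) E
        have := hf (e (0, y)) 0 x
        rw [he] at this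
        rw [Fin.update_cons_zero] at this
        simpa [he] using this
    refine step.trans ?_
    have hgi2 : Integrable (fun y => (g y - E) ^ 2) π' := (hgL.sub (memLp_const E)).integrable_sq
    rw [integral_add (integrable_const _) hgi2,
      Fin.sum_univ_succ]
    rw [hEg]
    simpa using ih

theorem efronStein_fin (n : ℕ) : ESProp n := by
  induction n with
  | zero =>
    intro μ _ hμ f hm c hf
    have : ∀ x, f x = f 0 := fun x => congrArg f (Subsingleton.elim _ _)
    simp [this]
  | succ n ih => exact efronStein_step n ih

theorem efronStein {ι : Type*} [Fintype ι] [DecidableEq ι] (μ : ι → Measure ℝ)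
    [∀ i, IsProbabilityMeasure (μ i)] (hμ : ∀ i, MemLp (fun x : ℝ => x) 2 (μ i))
    (f : (ι → ℝ) → ℝ) (hm : Measurable f) (c : ι → ℝ)
    (hf : ∀ x i y, |f (Function.update x i y) - f x| ≤ c i * |y - x i|) :
    ∫ x, (f x - ∫ y, f y ∂(Measure.pi μ)) ^ 2 ∂(Measure.pi μ)
      ≤ ∑ i, c i ^ 2 * ∫ x, x ^ 2 ∂(μ i) := by
  let e := (Fintype.equivFin ι).symm
  have mp := measurePreserving_piCongrLeft μ e
  let E := MeasurableEquiv.piCongrLeft (fun _ : ι => ℝ) e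
  have hE : ∀ (x : Fin (Fintype.card ι) → ℝ) i, E x (e i) = x i := by
    intro x i
    simp [E, MeasurableEquiv.coe_piCongrLeft]
  rw [← mp.integral_comp', ← mp.integral_comp' (g := f), ← e.sum_comp]
  refine efronStein_fin _ (fun j => μ (e j)) (fun j => inferInstance) (fun j => hμ _) (fun x => f (E x))
    (hm.comp E.measurable) (fun j => c (e j)) ?_
  intro x i y
  have h1 : E (Function.update x i y) = Function.update (E x) (e i) y := by
    ext k
    obtain ⟨j, rfl⟩ := e.surjective k
    rw [hE]
    by_cases h : j = i
    · subst h; simp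
    · have : e j ≠ e i := fun h' => h (e.injective h')
      simp [h, hE]
  rw [h1]
  have := hf (E x) (e i) y
  rwa [hE] at this



instance stdG_prob : IsProbabilityMeasure stdG := by unfold stdG; infer_instance

theorem stdG_shift (c : ℝ) :
    stdG.map (fun x => c + x) = stdG.withDensity (fun x => ENNReal.ofReal (exp (c * x - c ^ 2 / 2))) := by
  unfold stdG
  rw [gaussianReal_map_const_add, gaussianReal_of_var_ne_zero _ one_ne_zero,
    gaussianReal_of_var_ne_zero _ one_ne_zero, ← withDensity_mul _ (measurable_gaussianPDF _ _) (by fun_prop)]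
  congr 1
  ext x
  simp only [Pi.mul_apply, gaussianPDF]
  rw [← ENNReal.ofReal_mul (gaussianPDFReal_nonneg _ _ _)]
  congr 1
  simp only [gaussianPDFReal]
  rw [mul_assoc _ (rexp _), ← exp_add]
  congr 2
  simp
  ring

theorem gauss_shift {ι : Type*} [Fintype ι] (c : ι → ℝ) :
    (Measure.pi fun _ : ι => stdG).map (fun W => c + W)
      = (Measure.pi fun _ : ι => stdG).withDensity
        (fun W => ENNReal.ofReal (exp (∑ i, (c i * W i - c i ^ 2 / 2)))) := by
  have h1 : (Measure.pi fun _ : ι => stdG).map (fun W => c + W)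
      = Measure.pi (fun i => stdG.map (fun x => c i + x)) := by
    have : ∀ i, IsProbabilityMeasure (stdG.map (fun x => c i + x)) := fun i =>
      Measure.isProbabilityMeasure_map (by fun_prop)
    rw [← Measure.pi_map_pi (fun i => by fun_prop)]
    rfl
  rw [h1]
  have : ∀ i, IsProbabilityMeasure (stdG.map (fun x => c i + x)) := fun i =>
      Measure.isProbabilityMeasure_map (by fun_prop)
  refine Measure.pi_eq ?_
  intro s hs
  rw [withDensity_apply _ (MeasurableSet.univ_pi hs), ← lintegral_indicator (MeasurableSet.univ_pi hs)]
  have h2 : ∀ W : ι → ℝ, (Set.univ.pi s).indicator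
      (fun W => ENNReal.ofReal (exp (∑ i, (c i * W i - c i ^ 2 / 2)))) W
      = ∏ i, (s i).indicator (fun x => ENNReal.ofReal (exp (c i * x - c i ^ 2 / 2))) (W i) := by
    intro W
    by_cases hW : W ∈ Set.univ.pi s
    · rw [Set.indicator_of_mem hW, exp_sum, ENNReal.ofReal_prod_of_nonneg (fun i _ => (exp_pos _).le)]
      refine Finset.prod_congr rfl fun i _ => ?_
      rw [Set.indicator_of_mem (hW i (Set.mem_univ i))]
    · rw [Set.indicator_of_notMem hW]
      simp only [Set.mem_pi, Set.mem_univ, true_implies, not_forall] at hW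
      obtain ⟨i, hi⟩ := hW
      exact (Finset.prod_eq_zero (Finset.mem_univ i) (Set.indicator_of_notMem hi _)).symm
  simp_rw [h2]
  have hmeas : ∀ i, Measurable ((s i).indicator (fun x => ENNReal.ofReal (exp (c i * x - c i ^ 2 / 2)))) :=
    fun i => Measurable.indicator (by fun_prop) (hs i)
  rw [lintegral_prod_eq_prod_lintegral_of_indepFun Finset.univ
    (fun i (W : ι → ℝ) => (s i).indicator (fun x => ENNReal.ofReal (exp (c i * x - c i ^ 2 / 2))) (W i))
    (iIndepFun_pi (fun i => (hmeas i).aemeasurable)) (fun i => (hmeas i).comp (measurable_pi_apply i))]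
  refine Finset.prod_congr rfl fun i _ => ?_
  rw [stdG_shift, withDensity_apply _ (hs i), ← lintegral_indicator (hs i)]
  exact (measurePreserving_eval (fun _ : ι => stdG) i).lintegral_comp (hmeas i)

theorem cm_integral {ι : Type*} [Fintype ι] (c : ι → ℝ) (F : (ι → ℝ) → ℝ) :
    ∫ W, F (c + W) ∂(Measure.pi fun _ : ι => stdG)
      = ∫ W, exp (∑ i, (c i * W i - c i ^ 2 / 2)) * F W ∂(Measure.pi fun _ : ι => stdG) := by
  have h := (MeasurableEquiv.addLeft c).measurableEmbedding.integral_map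
    (μ := Measure.pi fun _ : ι => stdG) F
  simp only [MeasurableEquiv.coe_addLeft] at h
  rw [← h, gauss_shift, integral_withDensity_eq_integral_toReal_smul (by fun_prop)
    (ae_of_all _ fun _ => ENNReal.ofReal_lt_top)]
  simp [ENNReal.toReal_ofReal (exp_pos _).le]

theorem cm_integrable {ι : Type*} [Fintype ι] (c : ι → ℝ) (F : (ι → ℝ) → ℝ)
    (hF : Integrable (fun W => F (c + W)) (Measure.pi fun _ : ι => stdG)) :
    Integrable (fun W => exp (∑ i, (c i * W i - c i ^ 2 / 2)) * F W)
      (Measure.pi fun _ : ι => stdG) := by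
  have h := (MeasurableEquiv.addLeft c).measurableEmbedding.integrable_map_iff
    (μ := Measure.pi fun _ : ι => stdG) (g := F)
  simp only [MeasurableEquiv.coe_addLeft] at h
  have h2 := h.2 hF
  rw [gauss_shift, integrable_withDensity_iff_integrable_smul' (by fun_prop)
    (ae_of_all _ fun _ => ENNReal.ofReal_lt_top)] at h2
  simpa [ENNReal.toReal_ofReal (exp_pos _).le] using h2

/-- Finite partition function. -/
def Zn {X : Type*} [Fintype X] (p : X → ℝ) (H : X → ℝ) : ℝ := ∑ x, p x * exp (H x)

/-- Finite Gibbs average. -/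
def gb {X : Type*} [Fintype X] (p : X → ℝ) (H : X → ℝ) (f : X → ℝ) : ℝ :=
  (∑ x, f x * (p x * exp (H x))) / Zn p H

/-- Bayes exponent. -/
def hN {X ι : Type*} [Fintype ι] (T : X → ι → ℝ) (Y : ι → ℝ) (x : X) : ℝ :=
  ∑ k, (T x k * Y k - T x k ^ 2 / 2)

section gbBasics
variable {X : Type*} [Fintype X] {p : X → ℝ}
  {H : X → ℝ}

theorem Zn_pos (hp : ∀ x, 0 ≤ p x) (hp1 : ∑ x, p x = 1)
    : 0 < Zn p H := by
  unfold Zn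
  have h : ∃ x, p x ≠ 0 := by
    by_contra hcon
    push Not at hcon
    simp [hcon] at hp1
  obtain ⟨x, hx⟩ := h
  refine Finset.sum_pos' (fun i _ => mul_nonneg (hp i) (exp_pos _).le) ⟨x, Finset.mem_univ x, ?_⟩
  exact mul_pos (lt_of_le_of_ne (hp x) (Ne.symm hx)) (exp_pos _)

theorem gb_mono (hp : ∀ x, 0 ≤ p x) (hp1 : ∑ x, p x = 1)
    {f g : X → ℝ} (h : ∀ x, f x ≤ g x) : gb p H f ≤ gb p H g := by
  unfold gb
  refine div_le_div_of_nonneg_right ?_ (Zn_pos hp hp1).le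
  exact Finset.sum_le_sum fun x _ => mul_le_mul_of_nonneg_right (h x) (mul_nonneg (hp x) (exp_pos _).le)

theorem gb_const (hp : ∀ x, 0 ≤ p x) (hp1 : ∑ x, p x = 1)
    (c : ℝ) : gb p H (fun _ => c) = c := by
  unfold gb
  rw [← Finset.mul_sum]
  exact mul_div_cancel_right₀ _ (Zn_pos hp hp1 (H := H)).ne'

theorem gb_add (f g : X → ℝ) : gb p H (fun x => f x + g x) = gb p H f + gb p H g := by
  unfold gb
  rw [← add_div, ← Finset.sum_add_distrib]
  simp_rw [add_mul]

theorem gb_smul (c : ℝ) (f : X → ℝ) : gb p H (fun x => c * f x) = c * gb p H f := by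
  unfold gb
  rw [← mul_div_assoc, Finset.mul_sum]
  simp_rw [mul_assoc]

theorem gb_sub (f g : X → ℝ) : gb p H (fun x => f x - g x) = gb p H f - gb p H g := by
  unfold gb
  rw [← sub_div, ← Finset.sum_sub_distrib]
  simp_rw [sub_mul]

theorem gb_abs_le (hp : ∀ x, 0 ≤ p x) (hp1 : ∑ x, p x = 1)
    (f : X → ℝ) : |gb p H f| ≤ gb p H (fun x => |f x|) := by
  rw [abs_le]
  constructor
  · have := gb_mono hp hp1 (H := H) (f := fun x => (-1) * |f x|) (g := f)
      (fun x => by linarith [neg_abs_le (f x)])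
    rw [gb_smul] at this
    linarith
  · exact gb_mono hp hp1 fun x => le_abs_self _

theorem gb_bound (hp : ∀ x, 0 ≤ p x) (hp1 : ∑ x, p x = 1)
    {f : X → ℝ} {C : ℝ} (h : ∀ x, |f x| ≤ C) : |gb p H f| ≤ C := by
  refine (gb_abs_le hp hp1 f).trans ?_
  refine (gb_mono hp hp1 h).trans (gb_const hp hp1 C).le

theorem gb_eq_sum (f : X → ℝ) : gb p H f = ∑ x, f x * (p x * exp (H x) / Zn p H) := by
  unfold gb
  rw [Finset.sum_div]
  simp_rw [mul_div_assoc]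

theorem gb_weight_bound (hp : ∀ x, 0 ≤ p x) (hp1 : ∑ x, p x = 1)
    (x : X) : |p x * exp (H x) / Zn p H| ≤ 1 := by
  have h0 : 0 ≤ p x * exp (H x) := mul_nonneg (hp x) (exp_pos _).le
  rw [abs_of_nonneg (div_nonneg h0 (Zn_pos hp hp1).le), div_le_one (Zn_pos hp hp1)]
  exact Finset.single_le_sum (f := fun x => p x * exp (H x))
    (fun i _ => mul_nonneg (hp i) (exp_pos _).le) (Finset.mem_univ x)

end gbBasics

theorem measurable_Zn {X Ω : Type*} [Fintype X] [MeasurableSpace Ω] (p : X → ℝ) (H : Ω → X → ℝ)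
    (hH : ∀ x, Measurable fun ω => H ω x) : Measurable fun ω => Zn p (H ω) := by
  unfold Zn
  exact Finset.measurable_sum _ fun x _ => ((hH x).exp).const_mul _

theorem measurable_gb {X Ω : Type*} [Fintype X] [MeasurableSpace Ω] (p : X → ℝ) (H f : Ω → X → ℝ)
    (hH : ∀ x, Measurable fun ω => H ω x) (hf : ∀ x, Measurable fun ω => f ω x) :
    Measurable fun ω => gb p (H ω) (f ω) := by
  unfold gb
  refine Measurable.div ?_ (measurable_Zn p H hH)
  exact Finset.measurable_sum _ fun x _ => (hf x).mul (((hH x).exp).const_mul _)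

theorem integrable_gb {X Ω : Type*} [Fintype X] [MeasurableSpace Ω] {μ : Measure Ω} {p : X → ℝ}
    (hp : ∀ x, 0 ≤ p x) (hp1 : ∑ x, p x = 1) (H f : Ω → X → ℝ)
    (hH : ∀ x, Measurable fun ω => H ω x) (hf : ∀ x, Integrable (fun ω => f ω x) μ) :
    Integrable (fun ω => gb p (H ω) (f ω)) μ := by
  simp_rw [gb_eq_sum]
  refine integrable_finsetSum _ fun x _ => ?_
  refine Integrable.mul_bdd (c := 1) (hf x) ?_ (ae_of_all _ fun ω => ?_)
  · exact ((((hH x).exp).const_mul _).div (measurable_Zn p H hH)).aestronglyMeasurable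
  · rw [Real.norm_eq_abs]
    exact gb_weight_bound hp hp1 x

theorem nishimori {X ι : Type*} [Fintype X] [Fintype ι] {p : X → ℝ}
    (hp : ∀ x, 0 ≤ p x) (hp1 : ∑ x, p x = 1) (T : X → ι → ℝ)
    (f : (ι → ℝ) → X → ℝ)
    (hInt : ∀ x x₀, Integrable (fun W => f (T x₀ + W) x) (Measure.pi fun _ : ι => stdG)) :
    ∑ x₀, p x₀ * ∫ W, gb p (hN T (T x₀ + W)) (f (T x₀ + W)) ∂(Measure.pi fun _ : ι => stdG)
      = ∑ x₀, p x₀ * ∫ W, f (T x₀ + W) x₀ ∂(Measure.pi fun _ : ι => stdG) := by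
  set γ := Measure.pi fun _ : ι => stdG with hγ
  have hHm : ∀ x, Measurable fun Y => hN T Y x := by
    intro x; unfold hN; fun_prop
  have e1 : ∀ x₀, ∫ W, gb p (hN T (T x₀ + W)) (f (T x₀ + W)) ∂γ
      = ∫ W, exp (hN T W x₀) * gb p (hN T W) (f W) ∂γ := fun x₀ =>
    cm_integral (T x₀) (fun Y => gb p (hN T Y) (f Y))
  have e2 : ∀ x₀, ∫ W, f (T x₀ + W) x₀ ∂γ = ∫ W, exp (hN T W x₀) * f W x₀ ∂γ := fun x₀ =>
    cm_integral (T x₀) (fun Y => f Y x₀)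
  have i1 : ∀ x₀, Integrable (fun W => exp (hN T W x₀) * gb p (hN T W) (f W)) γ := fun x₀ =>
    cm_integrable (T x₀) (fun Y => gb p (hN T Y) (f Y))
      (integrable_gb hp hp1 (fun W => hN T (T x₀ + W)) (fun W => f (T x₀ + W))
        (fun x => (hHm x).comp (by fun_prop)) (fun x => hInt x x₀))
  have i2 : ∀ x₀, Integrable (fun W => exp (hN T W x₀) * f W x₀) γ := fun x₀ =>
    cm_integrable (T x₀) (fun Y => f Y x₀) (hInt x₀ x₀)
  simp_rw [e1, e2, ← integral_const_mul]
  rw [← integral_finsetSum _ fun x _ => (i1 x).const_mul _,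
    ← integral_finsetSum _ fun x _ => (i2 x).const_mul _]
  congr 1
  ext W
  simp_rw [← mul_assoc]
  rw [← Finset.sum_mul]
  unfold gb
  rw [show ∑ i, p i * exp (hN T W i) = Zn p (hN T W) from rfl,
    mul_div_cancel₀ _ (Zn_pos hp hp1 (H := hN T W)).ne']
  exact Finset.sum_congr rfl fun x _ => by ring



section coreSec
variable {X : Type*} [Fintype X] {p : X → ℝ}

theorem gb_exp_eq (hp : ∀ x, 0 ≤ p x) (hp1 : ∑ x, p x = 1) (H H' : X → ℝ) :
    gb p H (fun x => exp (H' x - H x)) = exp (log (Zn p H') - log (Zn p H)) := by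
  rw [exp_sub, exp_log (Zn_pos hp hp1), exp_log (Zn_pos hp hp1)]
  unfold gb
  congr 1
  unfold Zn
  refine Finset.sum_congr rfl fun x _ => ?_
  show exp (H' x - H x) * (p x * exp (H x)) = p x * exp (H' x)
  rw [exp_sub]
  field_simp

theorem gb_jensen (hp : ∀ x, 0 ≤ p x) (hp1 : ∑ x, p x = 1) (H f : X → ℝ) :
    exp (gb p H f) ≤ gb p H (fun x => exp (f x)) := by
  have h1 : ∀ x, exp (gb p H f) * (1 + (f x - gb p H f)) ≤ exp (f x) := by
    intro x
    have := add_one_le_exp (f x - gb p H f)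
    calc exp (gb p H f) * (1 + (f x - gb p H f))
        ≤ exp (gb p H f) * exp (f x - gb p H f) :=
          mul_le_mul_of_nonneg_left (by linarith) (exp_pos _).le
      _ = exp (f x) := by rw [← exp_add]; ring_nf
  have h2 := gb_mono hp hp1 (H := H) h1
  rw [gb_smul, gb_add, gb_const hp hp1, gb_sub, gb_const hp hp1] at h2
  linarith

/-- Lower tangent bound for the log partition function. -/
theorem logZ_tangent (hp : ∀ x, 0 ≤ p x) (hp1 : ∑ x, p x = 1) (H H' : X → ℝ) :
    gb p H (fun x => H' x - H x) ≤ log (Zn p H') - log (Zn p H) := by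
  have := gb_jensen hp hp1 H (fun x => H' x - H x)
  rw [gb_exp_eq hp hp1] at this
  exact exp_le_exp.1 this

theorem logZ_lip (hp : ∀ x, 0 ≤ p x) (hp1 : ∑ x, p x = 1) (H H' : X → ℝ) (δ : ℝ)
    (h : ∀ x, |H' x - H x| ≤ δ) : |log (Zn p H') - log (Zn p H)| ≤ δ := by
  have h1 := logZ_tangent hp hp1 H H'
  have h2 := logZ_tangent hp hp1 H' H
  have h3 := abs_le.1 (gb_bound hp hp1 (H := H) h)
  have h4 := abs_le.1 (gb_bound hp hp1 (H := H') (f := fun x => H x - H' x) (C := δ)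
    (fun x => by rw [abs_sub_comm]; exact h x))
  rw [abs_le]
  constructor <;> linarith

theorem gb_pos_part (hp : ∀ x, 0 ≤ p x) (hp1 : ∑ x, p x = 1) (H H' g : X → ℝ) (k r : ℝ)
    (hk : 0 < k) (h : ∀ x, H x + k * g x - r ≤ H' x) :
    k * gb p H (fun x => max (g x) 0) ≤
      log 2 + max 0 (log (Zn p H') - log (Zn p H) + r) := by
  have h1 := gb_jensen hp hp1 H (fun x => k * max (g x) 0)
  rw [gb_smul] at h1
  have h2 : ∀ x, exp (k * max (g x) 0) ≤ 1 + exp r * exp (H' x - H x) := by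
    intro x
    rcases le_total (g x) 0 with hg | hg
    · rw [max_eq_right hg]; simp; positivity
    · rw [max_eq_left hg, ← exp_add]
      have : exp (k * g x) ≤ exp (r + (H' x - H x)) := exp_le_exp.2 (by linarith [h x])
      linarith
  have h3 := gb_mono hp hp1 (H := H) h2
  rw [gb_add, gb_const hp hp1, gb_smul, gb_exp_eq hp hp1, ← exp_add] at h3
  set q := log (Zn p H') - log (Zn p H) + r
  have h4 : 1 + exp (r + (log (Zn p H') - log (Zn p H))) ≤ 2 * exp (max 0 q) := by
    have e1 : exp 0 ≤ exp (max 0 q) := exp_le_exp.2 (le_max_left _ _)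
    have e2 : exp q ≤ exp (max 0 q) := exp_le_exp.2 (le_max_right _ _)
    rw [exp_zero] at e1
    rw [add_comm r]
    linarith
  have h5 := (h1.trans h3).trans h4
  have h6 : (2 : ℝ) * exp (max 0 q) = exp (log 2 + max 0 q) := by
    rw [exp_add, exp_log (by norm_num)]
  rw [h6] at h5
  exact exp_le_exp.1 h5

variable {Ω : Type*} [MeasurableSpace Ω]

/-- Convexity core: the fluctuations of `U` are controlled by those of the free energy. -/
theorem core_ineq (hp : ∀ x, 0 ≤ p x) (hp1 : ∑ x, p x = 1) (μ : Measure Ω) [IsProbabilityMeasure μ]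
    (H U : ℝ → Ω → X → ℝ) (B : Ω → X → ℝ) (m C1 V : ℝ) (hm : 0 < m)
    (hHU : ∀ a b ω x, H b ω x = H a ω x + m * ((b - a) * U a ω x + (b - a) ^ 2 * B ω x))
    (hHm : ∀ a x, Measurable fun ω => H a ω x)
    (hUi : ∀ a x, Integrable (fun ω => U a ω x) μ)
    (hB : ∀ᵐ ω ∂μ, ∀ x, |B ω x| ≤ C1)
    (P : ℝ → ℝ) (hP : ∀ a, P a = ∫ ω, gb p (H a ω) (U a ω) ∂μ)
    (a t : ℝ) (ht : 0 < t)
    (hLi : ∀ b, Integrable (fun ω => log (Zn p (H b ω))) μ)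
    (hV : ∀ b, a - t ≤ b → b ≤ a + t →
      ∫ ω, |log (Zn p (H b ω)) - ∫ ω', log (Zn p (H b ω')) ∂μ| ∂μ ≤ V) :
    ∫ ω, gb p (H a ω) (fun x => |U a ω x - P a|) ∂μ
      ≤ (2 * log 2 + 4 * V) / (m * t) + (P (a + t) - P (a - t)) + 4 * C1 * t := by
  set L : ℝ → Ω → ℝ := fun b ω => log (Zn p (H b ω)) with hL
  set Λ : ℝ → ℝ := fun b => ∫ ω, L b ω ∂μ with hΛ
  have hgUi : ∀ b, Integrable (fun ω => gb p (H b ω) (U b ω)) μ := fun b =>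
    integrable_gb hp hp1 _ _ (hHm b) (hUi b)
  -- pathwise tangent inequality
  have tang : ∀ b b' : ℝ, ∀ᵐ ω ∂μ,
      m * ((b' - b) * gb p (H b ω) (U b ω)) - m * C1 * (b' - b) ^ 2 ≤ L b' ω - L b ω := by
    intro b b'
    filter_upwards [hB] with ω hω
    have h1 := logZ_tangent hp hp1 (H b ω) (H b' ω)
    have h2 : ∀ x, m * (b' - b) * U b ω x + -(m * C1 * (b' - b) ^ 2) ≤ H b' ω x - H b ω x := by
      intro x
      rw [hHU b b' ω x]
      have h3 := (abs_le.1 (hω x)).1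
      have h4 : 0 ≤ m * (b' - b) ^ 2 := by positivity
      nlinarith
    have h5 := gb_mono hp hp1 (H := H b ω) h2
    rw [gb_add, gb_smul, gb_const hp hp1] at h5
    linarith
  have tangE : ∀ b b' : ℝ, m * ((b' - b) * P b) - m * C1 * (b' - b) ^ 2 ≤ Λ b' - Λ b := by
    intro b b'
    have h1 : ∫ ω, (m * ((b' - b) * gb p (H b ω) (U b ω)) - m * C1 * (b' - b) ^ 2) ∂μ
        ≤ ∫ ω, (L b' ω - L b ω) ∂μ := by
      refine integral_mono_ae ?_ ((hLi b').sub (hLi b)) (tang b b')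
      exact (((hgUi b).const_mul _).const_mul _).sub (integrable_const _)
    rw [integral_sub (hLi b') (hLi b), integral_sub (((hgUi b).const_mul _).const_mul _)
      (integrable_const _), integral_const_mul, integral_const_mul, ← hP] at h1
    simpa using h1
  have mono1 : 0 ≤ m * t * (P (a + t) - P a + 2 * C1 * t) := by
    have h1 := tangE a (a + t)
    have h2 := tangE (a + t) a
    ring_nf at h1 h2 ⊢
    linarith
  have mono2 : 0 ≤ m * t * (P a - P (a - t) + 2 * C1 * t) := by
    have h1 := tangE a (a - t)
    have h2 := tangE (a - t) a
    ring_nf at h1 h2 ⊢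
    linarith
  set D : ℝ → Ω → ℝ := fun b ω => |L b ω - Λ b| with hD
  have hDi : ∀ b, Integrable (D b) μ := fun b => ((hLi b).sub (integrable_const _)).abs
  have main : ∀ᵐ ω ∂μ, m * t * gb p (H a ω) (fun x => |U a ω x - P a|) ≤
      2 * log 2 + D (a + t) ω + D (a - t) ω + 2 * D a ω
        + (m * t * (P (a + t) - P (a - t)) + 4 * m * C1 * t ^ 2) := by
    filter_upwards [hB] with ω hω
    have hsplit : (fun x => |U a ω x - P a|)
        = fun x => max (U a ω x - P a) 0 + max (P a - U a ω x) 0 := by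
      ext x
      rcases le_total (U a ω x) (P a) with h | h
      · rw [abs_of_nonpos (by linarith), max_eq_right (by linarith), max_eq_left (by linarith)]; ring
      · rw [abs_of_nonneg (by linarith), max_eq_left (by linarith), max_eq_right (by linarith)]; ring
    rw [hsplit, gb_add, mul_add]
    have p1 := gb_pos_part hp hp1 (H a ω) (H (a + t) ω) (fun x => U a ω x - P a) (m * t)
      (-(m * t * P a) + m * C1 * t ^ 2) (by positivity) (by
        intro x
        rw [hHU a (a + t) ω x]
        have h3 := (abs_le.1 (hω x)).1
        have h4 : 0 ≤ m * t ^ 2 := by positivity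
        nlinarith)
    have p2 := gb_pos_part hp hp1 (H a ω) (H (a - t) ω) (fun x => P a - U a ω x) (m * t)
      (m * t * P a + m * C1 * t ^ 2) (by positivity) (by
        intro x
        rw [hHU a (a - t) ω x]
        have h3 := (abs_le.1 (hω x)).1
        have h4 : 0 ≤ m * t ^ 2 := by positivity
        nlinarith)
    have d1 := abs_le.1 (le_refl (D (a + t) ω))
    have d2 := abs_le.1 (le_refl (D (a - t) ω))
    have d3 := abs_le.1 (le_refl (D a ω))
    have e1 := tangE (a + t) a
    have e2 := tangE (a - t) a
    have n1 : 0 ≤ D (a + t) ω := abs_nonneg _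
    have n2 : 0 ≤ D (a - t) ω := abs_nonneg _
    have n3 : 0 ≤ D a ω := abs_nonneg _
    have q1 : max 0 (L (a + t) ω - L a ω + (-(m * t * P a) + m * C1 * t ^ 2))
        ≤ D (a + t) ω + D a ω + m * t * (P (a + t) - P a + 2 * C1 * t) := by
      refine max_le (by linarith) ?_
      ring_nf at e1 d1 d3 ⊢
      linarith [d1.2, d3.1]
    have q2 : max 0 (L (a - t) ω - L a ω + (m * t * P a + m * C1 * t ^ 2))
        ≤ D (a - t) ω + D a ω + m * t * (P a - P (a - t) + 2 * C1 * t) := by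
      refine max_le (by linarith) ?_
      ring_nf at e2 d2 d3 ⊢
      linarith [d2.2, d3.1]
    have : m * t * (P (a + t) - P a + 2 * C1 * t) + m * t * (P a - P (a - t) + 2 * C1 * t)
      = (m * t * (P (a + t) - P (a - t)) + 4 * m * C1 * t ^ 2) := by ring
    linarith
  have hgi : Integrable (fun ω => gb p (H a ω) (fun x => |U a ω x - P a|)) μ :=
    integrable_gb hp hp1 _ (fun ω x => |U a ω x - P a|) (hHm a)
      (fun x => ((hUi a x).sub (integrable_const _)).abs)
  have fin1 : m * t * ∫ ω, gb p (H a ω) (fun x => |U a ω x - P a|) ∂μ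
      ≤ 2 * log 2 + 4 * V + (m * t * (P (a + t) - P (a - t)) + 4 * m * C1 * t ^ 2) := by
    rw [← integral_const_mul]
    have j1 : Integrable (fun ω => 2 * log 2 + D (a + t) ω) μ := (integrable_const _).add (hDi _)
    have j2 : Integrable (fun ω => 2 * log 2 + D (a + t) ω + D (a - t) ω) μ := j1.add (hDi _)
    have j3 : Integrable (fun ω => 2 * log 2 + D (a + t) ω + D (a - t) ω + 2 * D a ω) μ :=
      j2.add ((hDi _).const_mul _)
    have j4 : Integrable (fun ω => 2 * log 2 + D (a + t) ω + D (a - t) ω + 2 * D a ω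
        + (m * t * (P (a + t) - P (a - t)) + 4 * m * C1 * t ^ 2)) μ := j3.add (integrable_const _)
    refine (integral_mono_ae (hgi.const_mul _) j4 main).trans ?_
    rw [integral_add j3 (integrable_const _), integral_add j2 ((hDi _).const_mul _),
      integral_add j1 (hDi _), integral_add (integrable_const _) (hDi _)]
    have v1 : ∫ ω, D (a + t) ω ∂μ ≤ V := hV (a + t) (by linarith) le_rfl
    have v2 : ∫ ω, D (a - t) ω ∂μ ≤ V := hV (a - t) le_rfl (by linarith)
    have v3 : ∫ ω, D a ω ∂μ ≤ V := hV a (by linarith) (by linarith)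
    have v4 : ∫ ω, 2 * D a ω ∂μ = 2 * ∫ ω, D a ω ∂μ := integral_const_mul _ _
    rw [v4]
    simp only [integral_const, probReal_univ, one_smul]
    linarith
  have hmt : 0 < m * t := by positivity
  have e : (2 * log 2 + 4 * V) / (m * t) + (P (a + t) - P (a - t)) + 4 * C1 * t
      = (2 * log 2 + 4 * V + (m * t * (P (a + t) - P (a - t)) + 4 * m * C1 * t ^ 2)) / (m * t) := by
    field_simp
    ring
  rw [e, le_div_iff₀ hmt]
  linarith

end coreSec



section absSec
variable {X ι : Type*} [Fintype X] [MeasurableSpace X] [MeasurableSingletonClass X] [Fintype ι]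

/-- Gaussian noise on a finite index set. -/
def gam (ι : Type*) [Fintype ι] : Measure (ι → ℝ) := Measure.pi fun _ : ι => stdG

instance gam_prob (ι : Type*) [Fintype ι] : IsProbabilityMeasure (gam ι) := by
  unfold gam; infer_instance

/-- Point masses. -/
def pwt (ν : Measure X) (x : X) : ℝ := ν.real {x}

theorem pwt_nonneg (ν : Measure X) (x : X) : 0 ≤ pwt ν x := measureReal_nonneg

theorem pwt_integral (ν : Measure X) [IsProbabilityMeasure ν] (f : X → ℝ) :
    ∫ x, f x ∂ν = ∑ x, pwt ν x * f x := by
  rw [integral_fintype Integrable.of_finite]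
  rfl

theorem pwt_sum (ν : Measure X) [IsProbabilityMeasure ν] : ∑ x, pwt ν x = 1 := by
  have := pwt_integral ν (fun _ => 1)
  simpa using this.symm

theorem measX {Y : Type*} [MeasurableSpace Y] (F : X × Y → ℝ) (hm : ∀ x, Measurable fun W => F (x, W)) :
    Measurable F := measurable_from_prod_countable_right hm

theorem intX (ν : Measure X) [IsProbabilityMeasure ν] (F : X × (ι → ℝ) → ℝ)
    (hm : ∀ x, Measurable fun W => F (x, W)) (hi : ∀ x, Integrable (fun W => F (x, W)) (gam ι)) :
    Integrable F (ν.prod (gam ι)) := by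
  rw [integrable_prod_iff (measX F hm).aestronglyMeasurable]
  exact ⟨ae_of_all _ hi, Integrable.of_finite⟩

theorem intX_eq (ν : Measure X) [IsProbabilityMeasure ν] (F : X × (ι → ℝ) → ℝ)
    (hm : ∀ x, Measurable fun W => F (x, W)) (hi : ∀ x, Integrable (fun W => F (x, W)) (gam ι)) :
    ∫ ω, F ω ∂(ν.prod (gam ι)) = ∑ x, pwt ν x * ∫ W, F (x, W) ∂(gam ι) := by
  rw [integral_prod _ (intX ν F hm hi), pwt_integral]

theorem measurable_hN (T : X → ι → ℝ) (x₀ x : X) : Measurable fun W => hN T (T x₀ + W) x := by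
  unfold hN
  simp only [Pi.add_apply]
  fun_prop

theorem nish (ν : Measure X) [IsProbabilityMeasure ν] (T : X → ι → ℝ) (f : (ι → ℝ) → X → ℝ)
    (hm : ∀ x, Measurable fun Y => f Y x)
    (hi : ∀ x x₀, Integrable (fun W => f (T x₀ + W) x) (gam ι)) :
    ∫ ω, gb (pwt ν) (hN T (T ω.1 + ω.2)) (f (T ω.1 + ω.2)) ∂(ν.prod (gam ι))
      = ∫ ω, f (T ω.1 + ω.2) ω.1 ∂(ν.prod (gam ι)) := by
  have hms : ∀ x x₀, Measurable fun W => f (T x₀ + W) x := fun x x₀ =>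
    (hm x).comp (measurable_const.add measurable_id)
  rw [intX_eq, intX_eq]
  · exact nishimori (pwt_nonneg ν) (pwt_sum ν) T f hi
  · intro x; exact hms x x
  · intro x; exact hi x x
  · intro x
    exact measurable_gb _ _ _ (measurable_hN T x) (fun x' => hms x' x)
  · intro x
    exact integrable_gb (pwt_nonneg ν) (pwt_sum ν) _ _ (measurable_hN T x) (fun x' => hi x' x)

theorem stdG_memLp : MemLp (fun x : ℝ => x) 2 stdG := by
  unfold stdG; exact memLp_id_gaussianReal 2

theorem stdG_sq : ∫ x, x ^ 2 ∂stdG = 1 := by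
  have h := variance_fun_id_gaussianReal (μ := 0) (v := 1)
  rw [variance_eq_integral (by fun_prop)] at h
  simpa [stdG, integral_id_gaussianReal] using h

theorem gam_coord (k : ι) : Integrable (fun W : ι → ℝ => W k) (gam ι) := by
  have h1 := (measurePreserving_eval (fun _ : ι => stdG) k)
  exact h1.integrable_comp_of_integrable (stdG_memLp.integrable (by norm_num))

theorem gam_coord_int (k : ι) : ∫ W, W k ∂(gam ι) = 0 := by
  have h1 := (measurePreserving_eval (fun _ : ι => stdG) k)
  have h2 := integral_map (μ := gam ι) (φ := Function.eval k) (f := fun x : ℝ => x)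
    (measurable_pi_apply k).aemeasurable (by fun_prop)
  have h3 : (gam ι).map (Function.eval k) = stdG := h1.map_eq
  rw [h3] at h2
  have : ∫ x, x ∂stdG = 0 := by unfold stdG; exact integral_id_gaussianReal
  rw [this] at h2
  exact h2.symm

theorem abs_le_sqrt_var {Ω : Type*} [MeasurableSpace Ω] (μ : Measure Ω) [IsProbabilityMeasure μ]
    (f : Ω → ℝ) (hf : MemLp f 2 μ) (C : ℝ) (h : ∫ ω, f ω ^ 2 ∂μ ≤ C) :
    ∫ ω, |f ω| ∂μ ≤ √C := by
  refine Real.le_sqrt_of_sq_le ?_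
  have h1 := variance_nonneg (fun ω => |f ω|) μ
  have hfa : MemLp (fun ω => |f ω|) 2 μ := hf.abs
  rw [variance_eq_sub hfa] at h1
  simp only [Pi.pow_apply, sq_abs] at h1
  linarith

theorem gam_lin_abs (c : ι → ℝ) (C : ℝ) (h : ∑ k, c k ^ 2 ≤ C) :
    ∫ W, |∑ k, c k * W k| ∂(gam ι) ≤ √C := by
  classical
  have hl : ∀ (x : ι → ℝ) i y, |(∑ k, c k * (Function.update x i y) k) - ∑ k, c k * x k|
      ≤ |c i| * |y - x i| := by
    intro x i y
    rw [← Finset.sum_sub_distrib, Finset.sum_eq_single i]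
    · rw [← mul_sub, abs_mul]; simp
    · intro b _ hb; simp [Function.update_of_ne hb]
    · simp
  have hme : Measurable fun W : ι → ℝ => ∑ k, c k * W k := by fun_prop
  have h1 := efronStein (fun _ : ι => stdG) (fun _ => stdG_memLp) _ hme (fun i => |c i|) hl
  have h2 := coordLip_memLp (fun _ : ι => stdG) (fun _ => stdG_memLp) _ hme (fun i => |c i|) hl
  have h0 : ∫ W, (∑ k, c k * W k) ∂(gam ι) = 0 := by
    rw [integral_finsetSum _ fun k _ => (gam_coord k).const_mul _]
    simp [integral_const_mul, gam_coord_int]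
  change ∫ x, ((∑ k, c k * x k) - ∫ W, (∑ k, c k * W k) ∂(gam ι)) ^ 2 ∂(gam ι) ≤ _ at h1
  rw [h0] at h1
  simp only [sub_zero, sq_abs, stdG_sq, mul_one] at h1
  exact abs_le_sqrt_var (gam ι) _ h2 C (h1.trans h)

end absSec



section ovSec
variable {X ι : Type*} [Fintype X] [MeasurableSpace X] [MeasurableSingletonClass X] [Fintype ι]

/-- Signal with a perturbation channel of strength `a * σ`. -/
def Tch (T0 y : X → ι → ℝ) (σ a : ℝ) (x : X) (k : ι) : ℝ := T0 x k + a * σ * y x k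

/-- Normalized overlap. -/
def Rov (y : X → ι → ℝ) (N : ℝ) (x x2 : X) : ℝ := (1 / N) * ∑ k, y x k * y x2 k

/-- Hamiltonian as a function of the sample `(x₀, W)`. -/
def HT (T : X → ι → ℝ) (ω : X × (ι → ℝ)) : X → ℝ := hN T (T ω.1 + ω.2)

/-- Derivative of the Hamiltonian in the strength. -/
def Uf (y : X → ι → ℝ) (σ N a : ℝ) (ω : X × (ι → ℝ)) (x : X) : ℝ :=
  (1 / N) * ∑ k, (y x k * ω.2 k / σ + 2 * a * (y ω.1 k * y x k) - a * y x k ^ 2)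

/-- Part of `Uf` depending on the observation only. -/
def Gf (y : X → ι → ℝ) (σ N a : ℝ) (Y : ι → ℝ) (x : X) : ℝ :=
  (1 / N) * ∑ k, (y x k * Y k / σ - a * y x k ^ 2)

/-- Second-order coefficient. -/
def Bf (y : X → ι → ℝ) (N : ℝ) (ω : X × (ι → ℝ)) (x : X) : ℝ :=
  (1 / N) * ∑ k, (y ω.1 k * y x k - y x k ^ 2 / 2)

variable (ν : Measure X) [IsProbabilityMeasure ν] (T0 y : X → ι → ℝ) (σ N K : ℝ)

theorem Rov_abs (hN0 : 0 < N) (hK : ∀ x, ∑ k, y x k ^ 2 ≤ N * K ^ 2) (x x' : X) :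
    |Rov y N x x'| ≤ K ^ 2 := by
  unfold Rov
  rw [abs_mul, abs_of_pos (by positivity), one_div, inv_mul_le_iff₀ hN0]
  refine abs_le_of_sq_le_sq ?_ (by positivity)
  refine (Finset.sum_mul_sq_le_sq_mul_sq _ _ _).trans ?_
  rw [sq (N * K ^ 2)]
  exact mul_le_mul (hK x) (hK x') (Finset.sum_nonneg fun _ _ => sq_nonneg _) (by positivity)

theorem Bf_abs (hN0 : 0 < N) (hK : ∀ x, ∑ k, y x k ^ 2 ≤ N * K ^ 2) (ω : X × (ι → ℝ)) (x : X) :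
    |Bf y N ω x| ≤ 2 * K ^ 2 := by
  have h1 := Rov_abs y N K hN0 hK ω.1 x
  have h2 := Rov_abs y N K hN0 hK x x
  have h3 : Bf y N ω x = Rov y N ω.1 x - Rov y N x x / 2 := by
    unfold Bf Rov
    rw [Finset.sum_sub_distrib, mul_sub, ← Finset.sum_div, mul_div_assoc]
    simp only [sq]
  rw [h3]
  rw [abs_le] at *
  constructor <;> linarith [sq_nonneg K]

theorem HT_expand (hN0 : 0 < N) (hσ : 0 < σ) (hT : ∀ x x' k, y x k * T0 x' k = 0)
    (a b : ℝ) (ω : X × (ι → ℝ)) (x : X) :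
    HT (Tch T0 y σ b) ω x = HT (Tch T0 y σ a) ω x
      + (N * σ ^ 2) * ((b - a) * Uf y σ N a ω x + (b - a) ^ 2 * Bf y N ω x) := by
  unfold HT hN Tch Uf Bf
  have e : N * σ ^ 2 * ((b - a) * (1 / N * ∑ k, (y x k * ω.2 k / σ + 2 * a * (y ω.1 k * y x k)
      - a * y x k ^ 2)) + (b - a) ^ 2 * (1 / N * ∑ k, (y ω.1 k * y x k - y x k ^ 2 / 2)))
      = ∑ k, ((b - a) * σ ^ 2 * (y x k * ω.2 k / σ + 2 * a * (y ω.1 k * y x k) - a * y x k ^ 2)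
        + (b - a) ^ 2 * σ ^ 2 * (y ω.1 k * y x k - y x k ^ 2 / 2)) := by
    rw [Finset.sum_add_distrib, ← Finset.mul_sum, ← Finset.mul_sum]
    field_simp
  rw [e, ← Finset.sum_add_distrib]
  refine Finset.sum_congr rfl fun k _ => ?_
  have h1 := hT x x k
  have h2 := hT x ω.1 k
  have h3 := hT ω.1 x k
  simp only [Pi.add_apply]
  field_simp
  linear_combination (-(b-a)*σ*2) * h1 + (b-a)*σ*2* h2 + (b-a)*σ*2*h3

theorem Uf_eq (hN0 : 0 < N) (hσ : 0 < σ) (hT : ∀ x x' k, y x k * T0 x' k = 0)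
    (a : ℝ) (ω : X × (ι → ℝ)) (x : X) :
    Uf y σ N a ω x = Gf y σ N a (Tch T0 y σ a ω.1 + ω.2) x + a * Rov y N ω.1 x := by
  unfold Uf Gf Tch Rov
  rw [mul_left_comm a, ← mul_add, Finset.mul_sum (a := a), ← Finset.sum_add_distrib]
  congr 1
  refine Finset.sum_congr rfl fun k _ => ?_
  have h2 := hT x ω.1 k
  simp only [Pi.add_apply]
  field_simp
  linear_combination (-1) * h2

theorem Uf_meas (a : ℝ) (x x₀ : X) : Measurable fun W => Uf y σ N a (x₀, W) x := by
  unfold Uf; fun_prop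

theorem Gf_meas (a : ℝ) (x : X) : Measurable fun Y => Gf y σ N a Y x := by
  unfold Gf; fun_prop

theorem Gf_meas2 (T : X → ι → ℝ) (a : ℝ) (x x₀ : X) :
    Measurable fun W => Gf y σ N a (T x₀ + W) x :=
  (Gf_meas y σ N a x).comp (measurable_const_add (T x₀))

theorem Uf_int (a : ℝ) (x x₀ : X) : Integrable (fun W => Uf y σ N a (x₀, W) x) (gam ι) := by
  unfold Uf
  refine (integrable_finsetSum _ fun k _ => ?_).const_mul _
  show Integrable (fun W : ι → ℝ => y x k * W k / σ + 2 * a * (y x₀ k * y x k) - a * y x k ^ 2) (gam ι)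
  exact ((((gam_coord k).const_mul _).div_const _).add (integrable_const _)).sub (integrable_const _)

theorem Gf_int (T : X → ι → ℝ) (a : ℝ) (x x₀ : X) :
    Integrable (fun W => Gf y σ N a (T x₀ + W) x) (gam ι) := by
  unfold Gf
  refine (integrable_finsetSum _ fun k _ => ?_).const_mul _
  simp only [Pi.add_apply]
  exact (((((integrable_const _).add (gam_coord k))).const_mul _).div_const _).sub
    (integrable_const _)

theorem HT_meas (T : X → ι → ℝ) (x : X) : Measurable fun ω => HT T ω x :=
  measX _ fun x₀ => measurable_hN T x₀ x

theorem E_absG (hN0 : 0 < N) (hσ : 0 < σ) (hK0 : 0 ≤ K) (hT : ∀ x x' k, y x k * T0 x' k = 0)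
    (hK : ∀ x, ∑ k, y x k ^ 2 ≤ N * K ^ 2) (a : ℝ) :
    ∫ ω, gb (pwt ν) (HT (Tch T0 y σ a) ω)
      (fun x => |Gf y σ N a (Tch T0 y σ a ω.1 + ω.2) x|) ∂(ν.prod (gam ι)) ≤ K / (σ * √N) := by
  have h := nish ν (Tch T0 y σ a) (fun Y x => |Gf y σ N a Y x|)
    (fun x => (Gf_meas y σ N a x).abs) (fun x x₀ => (Gf_int y σ N (Tch T0 y σ a) a x x₀).abs)
  unfold HT
  rw [h, intX_eq ν (fun ω => |Gf y σ N a (Tch T0 y σ a ω.1 + ω.2) ω.1|)]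
  rotate_left
  · intro x
    exact (Gf_meas2 y σ N (Tch T0 y σ a) a x x).abs
  · intro x; exact (Gf_int y σ N (Tch T0 y σ a) a x x).abs
  have key : ∀ x, ∫ W, |Gf y σ N a (Tch T0 y σ a x + W) x| ∂(gam ι) ≤ K / (σ * √N) := by
    intro x
    have e : ∀ W : ι → ℝ, Gf y σ N a (Tch T0 y σ a x + W) x
        = ∑ k, (y x k / (N * σ)) * W k := by
      intro W
      unfold Gf Tch
      rw [Finset.mul_sum]
      refine Finset.sum_congr rfl fun k _ => ?_
      have h1 := hT x x k
      simp only [Pi.add_apply]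
      field_simp
      linear_combination h1
    simp_rw [e]
    refine (gam_lin_abs _ ((K / (σ * √N)) ^ 2) ?_).trans ?_
    · simp_rw [div_pow]
      rw [← Finset.sum_div, mul_pow, mul_pow, Real.sq_sqrt hN0.le, div_le_div_iff₀ (by positivity) (by positivity)]
      have := hK x
      have h3 : 0 ≤ σ ^ 2 * N := by positivity
      nlinarith
    · rw [Real.sqrt_sq (by positivity)]
  calc ∑ x, pwt ν x * ∫ W, |Gf y σ N a (Tch T0 y σ a x + W) x| ∂(gam ι)
      ≤ ∑ x, pwt ν x * (K / (σ * √N)) :=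
        Finset.sum_le_sum fun x _ => mul_le_mul_of_nonneg_left (key x) (pwt_nonneg ν x)
    _ = K / (σ * √N) := by rw [← Finset.sum_mul, pwt_sum, one_mul]

theorem intX_bdd (φ : X × (ι → ℝ) → X → ℝ) (hm : ∀ x x₀, Measurable fun W => φ (x₀, W) x)
    (hi : ∀ x x₀, Integrable (fun W => φ (x₀, W) x) (gam ι)) (T : X → ι → ℝ) :
    Integrable (fun ω => gb (pwt ν) (HT T ω) (φ ω)) (ν.prod (gam ι)) := by
  refine integrable_gb (pwt_nonneg ν) (pwt_sum ν) _ _ (HT_meas T) fun x => ?_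
  exact intX ν _ (fun x₀ => hm x x₀) (fun x₀ => hi x x₀)

/-- Averaged derivative. -/
def Pf (a : ℝ) : ℝ :=
  ∫ ω, gb (pwt ν) (HT (Tch T0 y σ a) ω) (Uf y σ N a ω) ∂(ν.prod (gam ι))

/-- Averaged overlap with the signal. -/
def Cf (a : ℝ) : ℝ :=
  ∫ ω, gb (pwt ν) (HT (Tch T0 y σ a) ω) (fun x => Rov y N ω.1 x) ∂(ν.prod (gam ι))

theorem Cf_int (a : ℝ) : Integrable (fun ω => gb (pwt ν) (HT (Tch T0 y σ a) ω)
    (fun x => Rov y N ω.1 x)) (ν.prod (gam ι)) :=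
  intX_bdd ν (fun ω x => Rov y N ω.1 x) (fun x x₀ => measurable_const (a := Rov y N x₀ x))
    (fun x x₀ => integrable_const (Rov y N x₀ x)) _

theorem Cf_abs (hN0 : 0 < N) (hK : ∀ x, ∑ k, y x k ^ 2 ≤ N * K ^ 2) (a : ℝ) :
    |Cf ν T0 y σ N a| ≤ K ^ 2 := by
  unfold Cf
  rw [← Real.norm_eq_abs]
  refine (norm_integral_le_of_norm_le_const (μ := ν.prod (gam ι)) (C := K ^ 2) (ae_of_all _ fun ω => ?_)).trans ?_
  · exact gb_bound (pwt_nonneg ν) (pwt_sum ν) fun x => Rov_abs y N K hN0 hK _ _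
  · simp

theorem G_int (a : ℝ) : Integrable (fun ω => gb (pwt ν) (HT (Tch T0 y σ a) ω)
    (Gf y σ N a (Tch T0 y σ a ω.1 + ω.2))) (ν.prod (gam ι)) :=
  intX_bdd ν (fun ω x => Gf y σ N a (Tch T0 y σ a ω.1 + ω.2) x)
    (fun x x₀ => Gf_meas2 y σ N (Tch T0 y σ a) a x x₀)
    (fun x x₀ => Gf_int y σ N (Tch T0 y σ a) a x x₀) _

theorem absG_int (a : ℝ) : Integrable (fun ω => gb (pwt ν) (HT (Tch T0 y σ a) ω)
    (fun x => |Gf y σ N a (Tch T0 y σ a ω.1 + ω.2) x|)) (ν.prod (gam ι)) :=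
  intX_bdd ν (fun ω x => |Gf y σ N a (Tch T0 y σ a ω.1 + ω.2) x|)
    (fun x x₀ => (Gf_meas2 y σ N (Tch T0 y σ a) a x x₀).abs)
    (fun x x₀ => (Gf_int y σ N (Tch T0 y σ a) a x x₀).abs) _

theorem Pf_abs (hN0 : 0 < N) (hσ : 0 < σ) (hK0 : 0 ≤ K) (hT : ∀ x x' k, y x k * T0 x' k = 0)
    (hK : ∀ x, ∑ k, y x k ^ 2 ≤ N * K ^ 2) (a : ℝ) :
    |Pf ν T0 y σ N a| ≤ |a| * K ^ 2 + K / (σ * √N) := by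
  have e : Pf ν T0 y σ N a = ∫ ω, gb (pwt ν) (HT (Tch T0 y σ a) ω)
      (Gf y σ N a (Tch T0 y σ a ω.1 + ω.2)) ∂(ν.prod (gam ι)) + a * Cf ν T0 y σ N a := by
    unfold Pf Cf
    rw [← integral_const_mul, ← integral_add (G_int ν T0 y σ N a) ((Cf_int ν T0 y σ N a).const_mul _)]
    congr 1
    ext ω
    rw [← gb_smul, ← gb_add]
    congr 1
    ext x
    exact Uf_eq T0 y σ N hN0 hσ hT a ω x
  rw [e, add_comm]
  refine (abs_add_le _ _).trans (add_le_add ?_ ?_)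
  · rw [abs_mul]
    exact mul_le_mul_of_nonneg_left (Cf_abs ν T0 y σ N K hN0 hK a) (abs_nonneg _)
  · refine (abs_integral_le_integral_abs).trans
      (le_trans ?_ (E_absG ν T0 y σ N K hN0 hσ hK0 hT hK a))
    refine integral_mono (G_int ν T0 y σ N a).abs (absG_int ν T0 y σ N a) fun ω => ?_
    exact gb_abs_le (pwt_nonneg ν) (pwt_sum ν) _


theorem replica_avg (T : X → ι → ℝ) (φ : X → X → ℝ) :
    ∫ ω, gb (pwt ν) (HT T ω) (fun x1 => gb (pwt ν) (HT T ω) (fun x2 => φ x1 x2)) ∂(ν.prod (gam ι))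
      = ∫ ω, gb (pwt ν) (HT T ω) (fun x2 => φ ω.1 x2) ∂(ν.prod (gam ι)) := by
  have hmY : ∀ x, Measurable fun Y : ι → ℝ => hN T Y x := by
    intro x; unfold hN; fun_prop
  refine nish ν T (fun Y x => gb (pwt ν) (hN T Y) (fun x2 => φ x x2)) ?_ ?_
  · intro x
    exact measurable_gb _ _ (fun _ x2 => φ x x2) hmY (fun _ => measurable_const)
  · intro x x₀
    exact integrable_gb (pwt_nonneg ν) (pwt_sum ν) (fun W => hN T (T x₀ + W)) (fun _ x2 => φ x x2)
      (fun x' => measurable_hN T x₀ x') (fun _ => integrable_const _)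

/-- Overlap fluctuations are controlled by those of `Uf`. -/
theorem ov_bound (hN0 : 0 < N) (hσ : 0 < σ) (hK0 : 0 ≤ K) (hT : ∀ x x' k, y x k * T0 x' k = 0)
    (hK : ∀ x, ∑ k, y x k ^ 2 ≤ N * K ^ 2) (a : ℝ) (ha : 1 ≤ a) (ε : ℝ)
    (hε : ∫ ω, gb (pwt ν) (HT (Tch T0 y σ a) ω)
      (fun x => |Uf y σ N a ω x - Pf ν T0 y σ N a|) ∂(ν.prod (gam ι)) ≤ ε) :
    ∫ ω, gb (pwt ν) (HT (Tch T0 y σ a) ω)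
      (fun x => (Rov y N ω.1 x - Cf ν T0 y σ N a) ^ 2) ∂(ν.prod (gam ι))
      ≤ 2 * K ^ 2 * (ε + K / (σ * √N)) := by
  set T := Tch T0 y σ a with hTd
  set P := Pf ν T0 y σ N a with hP
  set c := Cf ν T0 y σ N a with hc
  have hG := E_absG ν T0 y σ N K hN0 hσ hK0 hT hK a
  have i1 : Integrable (fun ω => gb (pwt ν) (HT T ω) (fun x => |Uf y σ N a ω x - P|))
      (ν.prod (gam ι)) :=
    intX_bdd ν (fun ω x => |Uf y σ N a ω x - P|)
      (fun x x₀ => ((Uf_meas y σ N a x x₀).sub measurable_const).abs)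
      (fun x x₀ => ((Uf_int y σ N a x x₀).sub (integrable_const _)).abs) _
  have i2 := absG_int ν T0 y σ N a
  have i3 := Cf_int ν T0 y σ N a
  have i4 : Integrable (fun ω => gb (pwt ν) (HT T ω) (fun x => (Rov y N ω.1 x - c) ^ 2))
      (ν.prod (gam ι)) :=
    intX_bdd ν (fun ω x => (Rov y N ω.1 x - c) ^ 2)
      (fun x x₀ => measurable_const (a := (Rov y N x₀ x - c) ^ 2))
      (fun x x₀ => integrable_const ((Rov y N x₀ x - c) ^ 2)) _
  have pt : ∀ ω, a * gb (pwt ν) (HT T ω) (fun x => (Rov y N ω.1 x - c) ^ 2)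
      ≤ 2 * K ^ 2 * (gb (pwt ν) (HT T ω) (fun x => |Uf y σ N a ω x - P|)
        + gb (pwt ν) (HT T ω) (fun x => |Gf y σ N a (T ω.1 + ω.2) x|))
        + (P - a * c) * (gb (pwt ν) (HT T ω) (fun x => Rov y N ω.1 x) - c) := by
    intro ω
    rw [← gb_add, ← gb_smul, ← gb_smul]
    have e : gb (pwt ν) (HT T ω) (fun x => Rov y N ω.1 x) - c
        = gb (pwt ν) (HT T ω) (fun x => Rov y N ω.1 x - c) := by
      rw [gb_sub, gb_const (pwt_nonneg ν) (pwt_sum ν)]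
    rw [e, ← gb_smul, ← gb_add]
    refine gb_mono (pwt_nonneg ν) (pwt_sum ν) fun x => ?_
    have hU := Uf_eq T0 y σ N hN0 hσ hT a ω x
    rw [← hTd] at hU
    set R := Rov y N ω.1 x
    set G := Gf y σ N a (T ω.1 + ω.2) x
    set U := Uf y σ N a ω x
    have hR : |R - c| ≤ 2 * K ^ 2 := by
      have r1 := abs_le.1 (Rov_abs y N K hN0 hK ω.1 x)
      have r2 := abs_le.1 (Cf_abs ν T0 y σ N K hN0 hK a)
      rw [abs_le]
      constructor <;> linarith [r1.1, r1.2, r2.1, r2.2]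
    have b1 : (R - c) * (U - P) ≤ 2 * K ^ 2 * |U - P| := by
      refine (le_abs_self _).trans ?_
      rw [abs_mul]
      exact mul_le_mul_of_nonneg_right hR (abs_nonneg _)
    have b2 : (R - c) * (-G) ≤ 2 * K ^ 2 * |G| := by
      refine (le_abs_self _).trans ?_
      rw [abs_mul, abs_neg]
      exact mul_le_mul_of_nonneg_right hR (abs_nonneg _)
    have : a * (R - c) ^ 2 = (R - c) * (U - P) + (R - c) * (-G) + (P - a * c) * (R - c) := by
      rw [hU]; ring
    linarith
  have j1 := i1.add i2
  have j2 : Integrable (fun ω => 2 * K ^ 2 * (gb (pwt ν) (HT T ω) (fun x => |Uf y σ N a ω x - P|)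
        + gb (pwt ν) (HT T ω) (fun x => |Gf y σ N a (T ω.1 + ω.2) x|))) (ν.prod (gam ι)) :=
    j1.const_mul _
  have j3 : Integrable (fun ω => (P - a * c) * (gb (pwt ν) (HT T ω)
      (fun x => Rov y N ω.1 x) - c)) (ν.prod (gam ι)) :=
    (i3.sub (integrable_const _)).const_mul _
  have j4 : Integrable (fun ω => 2 * K ^ 2 * (gb (pwt ν) (HT T ω) (fun x => |Uf y σ N a ω x - P|)
        + gb (pwt ν) (HT T ω) (fun x => |Gf y σ N a (T ω.1 + ω.2) x|))
        + (P - a * c) * (gb (pwt ν) (HT T ω) (fun x => Rov y N ω.1 x) - c)) (ν.prod (gam ι)) :=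
    j2.add j3
  have h1 := integral_mono (i4.const_mul a) j4 pt
  have e2 : ∫ ω, (2 * K ^ 2 * (gb (pwt ν) (HT T ω) (fun x => |Uf y σ N a ω x - P|)
        + gb (pwt ν) (HT T ω) (fun x => |Gf y σ N a (T ω.1 + ω.2) x|)) +
        (P - a * c) * (gb (pwt ν) (HT T ω) (fun x => Rov y N ω.1 x) - c)) ∂(ν.prod (gam ι))
      = 2 * K ^ 2 * (∫ ω, gb (pwt ν) (HT T ω) (fun x => |Uf y σ N a ω x - P|) ∂(ν.prod (gam ι))
        + ∫ ω, gb (pwt ν) (HT T ω) (fun x => |Gf y σ N a (T ω.1 + ω.2) x|) ∂(ν.prod (gam ι))) := by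
    rw [integral_add j2 j3, integral_const_mul, integral_const_mul, integral_add i1 i2,
      integral_sub i3 (integrable_const _)]
    have : ∫ ω, gb (pwt ν) (HT T ω) (fun x => Rov y N ω.1 x) ∂(ν.prod (gam ι)) = c := hc.symm
    rw [this]
    simp
    exact Or.inl rfl
  rw [e2, integral_const_mul] at h1
  have h0 : 0 ≤ ∫ ω, gb (pwt ν) (HT T ω) (fun x => (Rov y N ω.1 x - c) ^ 2) ∂(ν.prod (gam ι)) := by
    refine integral_nonneg fun ω => ?_
    have := gb_mono (pwt_nonneg ν) (pwt_sum ν) (H := HT T ω) (f := fun _ => 0)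
      (g := fun x => (Rov y N ω.1 x - c) ^ 2) (fun x => sq_nonneg _)
    rwa [gb_const (pwt_nonneg ν) (pwt_sum ν)] at this
  have h2 : 2 * K ^ 2 * (∫ ω, gb (pwt ν) (HT T ω) (fun x => |Uf y σ N a ω x - P|) ∂(ν.prod (gam ι))
        + ∫ ω, gb (pwt ν) (HT T ω) (fun x => |Gf y σ N a (T ω.1 + ω.2) x|) ∂(ν.prod (gam ι)))
      ≤ 2 * K ^ 2 * (ε + K / (σ * √N)) :=
    mul_le_mul_of_nonneg_left (add_le_add hε hG) (by positivity)
  nlinarith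

/-- Abstract overlap concentration at fixed strength. -/
theorem ov_main (hN0 : 0 < N) (hσ : 0 < σ) (hK0 : 0 ≤ K) (hT : ∀ x x' k, y x k * T0 x' k = 0)
    (hK : ∀ x, ∑ k, y x k ^ 2 ≤ N * K ^ 2) (a : ℝ) (ha : 1 ≤ a) (t V : ℝ) (ht : 0 < t)
    (hLi : ∀ b, Integrable (fun ω => log (Zn (pwt ν) (HT (Tch T0 y σ b) ω))) (ν.prod (gam ι)))
    (hV : ∀ b, a - t ≤ b → b ≤ a + t →
      ∫ ω, |log (Zn (pwt ν) (HT (Tch T0 y σ b) ω))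
        - ∫ ω', log (Zn (pwt ν) (HT (Tch T0 y σ b) ω')) ∂(ν.prod (gam ι))| ∂(ν.prod (gam ι)) ≤ V) :
    ∫ ω, gb (pwt ν) (HT (Tch T0 y σ a) ω) (fun x1 => gb (pwt ν) (HT (Tch T0 y σ a) ω) (fun x2 =>
      (Rov y N x1 x2 - ∫ ω, gb (pwt ν) (HT (Tch T0 y σ a) ω) (fun x1 =>
        gb (pwt ν) (HT (Tch T0 y σ a) ω) (fun x2 => Rov y N x1 x2)) ∂(ν.prod (gam ι))) ^ 2))
        ∂(ν.prod (gam ι))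
      ≤ 2 * K ^ 2 * (((2 * log 2 + 4 * V) / (N * σ ^ 2 * t)
        + (Pf ν T0 y σ N (a + t) - Pf ν T0 y σ N (a - t)) + 4 * (2 * K ^ 2) * t)
          + K / (σ * √N)) := by
  rw [replica_avg ν (Tch T0 y σ a) (fun x1 x2 => Rov y N x1 x2)]
  rw [replica_avg ν (Tch T0 y σ a) (fun x1 x2 => (Rov y N x1 x2 - ∫ ω, gb (pwt ν)
    (HT (Tch T0 y σ a) ω) (fun x2 => Rov y N ω.1 x2) ∂(ν.prod (gam ι))) ^ 2)]
  refine ov_bound ν T0 y σ N K hN0 hσ hK0 hT hK a ha _ ?_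
  exact core_ineq (pwt_nonneg ν) (pwt_sum ν) (ν.prod (gam ι)) (fun b ω => HT (Tch T0 y σ b) ω)
    (fun b ω => Uf y σ N b ω) (fun ω => Bf y N ω) (N * σ ^ 2) (2 * K ^ 2) V (by positivity)
    (fun a b ω x => HT_expand T0 y σ N hN0 hσ hT a b ω x)
    (fun b x => HT_meas _ x)
    (fun b x => intX ν _ (fun x₀ => Uf_meas y σ N b x x₀) (fun x₀ => Uf_int y σ N b x x₀))
    (ae_of_all _ fun ω x => Bf_abs y N K hN0 hK ω x)
    (Pf ν T0 y σ N) (fun b => rfl) a t ht hLi hV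

end ovSec



section flatSec

theorem mp_split (α β : Type*) [Fintype α] [Fintype β] :
    MeasurePreserving (fun W : α ⊕ β → ℝ => ((fun a => W (Sum.inl a), fun b => W (Sum.inr b)) :
      (α → ℝ) × (β → ℝ))) (gam (α ⊕ β)) ((gam α).prod (gam β)) :=
  measurePreserving_sumPiEquivProdPi (X := fun _ : α ⊕ β => ℝ) (fun _ => stdG)

theorem mp_join (α β : Type*) [Fintype α] [Fintype β] (μ : α ⊕ β → Measure ℝ)
    [∀ i, IsProbabilityMeasure (μ i)] :
    MeasurePreserving (fun p : (α → ℝ) × (β → ℝ) => (Sum.elim p.1 p.2 : α ⊕ β → ℝ))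
      ((Measure.pi fun a => μ (Sum.inl a)).prod (Measure.pi fun b => μ (Sum.inr b)))
      (Measure.pi μ) := by
  have h := measurePreserving_sumPiEquivProdPi_symm (X := fun _ : α ⊕ β => ℝ) μ
  convert h using 1
  ext p k
  cases k <;> rfl

theorem mp_curry (α β : Type*) [Fintype α] [Fintype β] :
    MeasurePreserving (fun W : α × β → ℝ => fun i j => W (i, j)) (gam (α × β))
      (Measure.pi fun _ : α => Measure.pi fun _ : β => stdG) := by
  have h : MeasurePreserving (MeasurableEquiv.curry α β ℝ).symm
      (Measure.pi fun _ : α => Measure.pi fun _ : β => stdG) (gam (α × β)) := by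
    refine ⟨(MeasurableEquiv.curry α β ℝ).symm.measurable, ?_⟩
    refine (Measure.pi_eq fun s hs => ?_).symm
    rw [Measure.map_apply (MeasurableEquiv.curry α β ℝ).symm.measurable
      (MeasurableSet.univ_pi hs)]
    have : (MeasurableEquiv.curry α β ℝ).symm ⁻¹' (Set.univ.pi s)
        = Set.univ.pi (fun i => Set.univ.pi (fun j => s (i, j))) := by
      ext Z
      simp [Set.mem_pi, MeasurableEquiv.coe_curry_symm, Function.uncurry]
    rw [this, Measure.pi_pi, Fintype.prod_prod_type]
    simp_rw [Measure.pi_pi]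
  exact h.symm

/-- The prior on the finite set. -/
def fin1 (S : Finset ℝ) (P : Measure ℝ) : Measure S := P.comap Subtype.val

theorem fin1_map (S : Finset ℝ) (P : Measure ℝ) (h : P ((↑S : Set ℝ)ᶜ) = 0) :
    (fin1 S P).map Subtype.val = P := by
  unfold fin1
  have he : MeasurableEmbedding (Subtype.val : S → ℝ) :=
    MeasurableEmbedding.subtype_coe (s := (↑S : Set ℝ)) S.measurableSet
  rw [he.map_comap, Subtype.range_coe_subtype]
  exact Measure.restrict_eq_self_of_ae_mem (by
    rw [ae_iff]; exact h)

theorem fin1_prob (S : Finset ℝ) (P : Measure ℝ) [IsProbabilityMeasure P]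
    (h : P ((↑S : Set ℝ)ᶜ) = 0) : IsProbabilityMeasure (fin1 S P) := by
  constructor
  have h1 := fin1_map S P h
  have h2 : (fin1 S P).map Subtype.val Set.univ = 1 := by rw [h1]; exact measure_univ
  rwa [Measure.map_apply measurable_subtype_coe MeasurableSet.univ, Set.preimage_univ] at h2

/-- Finite configuration space. -/
abbrev XS (S : Finset ℝ) (n : ℕ) : Type := (Fin n → S) × (Fin n → S)

/-- Noise index set. -/
abbrev IS (n : ℕ) : Type := (Fin n × Fin n) ⊕ ((Fin n ⊕ Fin n) ⊕ (Fin n ⊕ Fin n))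

/-- Embedding of configurations. -/
def ec {S : Finset ℝ} {n : ℕ} (x : XS S n) : (Fin n → ℝ) × (Fin n → ℝ) :=
  (fun i => (x.1 i : ℝ), fun i => (x.2 i : ℝ))

/-- Prior on the finite configuration space. -/
def nuS (S : Finset ℝ) (PU PV : Measure ℝ) (n : ℕ) : Measure (XS S n) :=
  (Measure.pi fun _ => fin1 S PU).prod (Measure.pi fun _ => fin1 S PV)

theorem nuS_prob (S : Finset ℝ) (PU PV : Measure ℝ) [IsProbabilityMeasure PU]
    [IsProbabilityMeasure PV] (hU : PU ((↑S : Set ℝ)ᶜ) = 0) (hV : PV ((↑S : Set ℝ)ᶜ) = 0)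
    (n : ℕ) : IsProbabilityMeasure (nuS S PU PV n) := by
  have := fin1_prob S PU hU
  have := fin1_prob S PV hV
  unfold nuS
  infer_instance

theorem ec_mp (S : Finset ℝ) (PU PV : Measure ℝ) [IsProbabilityMeasure PU]
    [IsProbabilityMeasure PV] (hU : PU ((↑S : Set ℝ)ᶜ) = 0) (hV : PV ((↑S : Set ℝ)ᶜ) = 0)
    (n : ℕ) : MeasurePreserving (ec (S := S) (n := n)) (nuS S PU PV n) (prior PU PV n) := by
  have := fin1_prob S PU hU
  have := fin1_prob S PV hV
  have h1 : MeasurePreserving (Subtype.val : S → ℝ) (fin1 S PU) PU :=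
    ⟨measurable_subtype_coe, fin1_map S PU hU⟩
  have h2 : MeasurePreserving (Subtype.val : S → ℝ) (fin1 S PV) PV :=
    ⟨measurable_subtype_coe, fin1_map S PV hV⟩
  have h3 := measurePreserving_pi (fun _ : Fin n => fin1 S PU) (fun _ => PU) (fun _ => h1)
  have h4 := measurePreserving_pi (fun _ : Fin n => fin1 S PV) (fun _ => PV) (fun _ => h2)
  exact h3.prod h4

/-- Rebuild the sample from configuration and flat noise. -/
def flatS {S : Finset ℝ} {n : ℕ} (ω : XS S n × (IS n → ℝ)) :
    ((((Fin n → ℝ) × (Fin n → ℝ)) × (Fin n → Fin n → ℝ)) ×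
      (((Fin n → ℝ) × (Fin n → ℝ)) × ((Fin n → ℝ) × (Fin n → ℝ)))) :=
  ((ec ω.1, fun i j => ω.2 (Sum.inl (i, j))),
    ((fun i => ω.2 (Sum.inr (Sum.inl (Sum.inl i))), fun i => ω.2 (Sum.inr (Sum.inl (Sum.inr i)))),
     (fun i => ω.2 (Sum.inr (Sum.inr (Sum.inl i))), fun i => ω.2 (Sum.inr (Sum.inr (Sum.inr i))))))

theorem flatS_mp (S : Finset ℝ) (PU PV : Measure ℝ) [IsProbabilityMeasure PU]
    [IsProbabilityMeasure PV] (hU : PU ((↑S : Set ℝ)ᶜ) = 0) (hV : PV ((↑S : Set ℝ)ᶜ) = 0)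
    (n : ℕ) : MeasurePreserving (flatS (S := S) (n := n)) ((nuS S PU PV n).prod (gam (IS n)))
      (sampleP PU PV n) := by
  have := nuS_prob S PU PV hU hV n
  have := fin1_prob S PU hU
  have := fin1_prob S PV hV
  have hp : IsProbabilityMeasure (prior PU PV n) := by unfold prior; infer_instance
  have hn : IsProbabilityMeasure (noiseM n) := by unfold noiseM; infer_instance
  have hg : IsProbabilityMeasure (gvec n) := by unfold gvec; infer_instance
  have m1 := mp_split (Fin n) (Fin n)
  have m2 := (m1.prod m1).comp (mp_split (Fin n ⊕ Fin n) (Fin n ⊕ Fin n))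
  have m3 := ((mp_curry (Fin n) (Fin n)).prod m2).comp (mp_split (Fin n × Fin n) _)
  have m4 := (ec_mp S PU PV hU hV n).prod m3
  have m5 := (measurePreserving_prodAssoc (prior PU PV n) (noiseM n)
    (((gvec n).prod (gvec n)).prod ((gvec n).prod (gvec n)))).symm
  exact m5.comp m4

end flatSec



section redSec

/-- Flat signal. -/
def Traw (lam qu qv : ℝ) (n : ℕ) (au av : ℝ) (U V : Fin n → ℝ) : IS n → ℝ
  | Sum.inl ij => √(lam / n) * U ij.1 * V ij.2
  | Sum.inr (Sum.inl (Sum.inl i)) => √(lam * qu) * U i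
  | Sum.inr (Sum.inl (Sum.inr i)) => √(lam * qv) * V i
  | Sum.inr (Sum.inr (Sum.inl i)) => au * √(sSeq n) * U i
  | Sum.inr (Sum.inr (Sum.inr i)) => av * √(sSeq n) * V i

/-- Flat signal of a configuration. -/
def TX (S : Finset ℝ) (lam qu qv : ℝ) (n : ℕ) (au av : ℝ) (x : XS S n) : IS n → ℝ :=
  Traw lam qu qv n au av (ec x).1 (ec x).2

theorem sSeq_nonneg (n : ℕ) : 0 ≤ sSeq n := by unfold sSeq; positivity

theorem HamTot_flat (S : Finset ℝ) (lam qu qv : ℝ) (hlam : 0 < lam) (hqu : 0 ≤ qu) (hqv : 0 ≤ qv)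
    (n : ℕ) (au av : ℝ) (ω : XS S n × (IS n → ℝ)) (x : XS S n) :
    HamTot lam qu qv n au av (flatS ω) (ec x).1 (ec x).2 = HT (TX S lam qu qv n au av) ω x := by
  unfold HamTot Ham HT hN TX flatS
  simp only [Fintype.sum_sum_type, Fintype.sum_prod_type, Traw, Pi.add_apply]
  have h1 : lam / n = √(lam / n) ^ 2 := (Real.sq_sqrt (by positivity)).symm
  have h1' : lam / (2 * n) = √(lam / n) ^ 2 / 2 := by rw [← h1, div_div, mul_comm]
  have h2 : lam * qu = √(lam * qu) ^ 2 := (Real.sq_sqrt (by positivity)).symm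
  have h3 : lam * qv = √(lam * qv) ^ 2 := (Real.sq_sqrt (by positivity)).symm
  have h4 : sSeq n = √(sSeq n) ^ 2 := (Real.sq_sqrt (sSeq_nonneg n)).symm
  have key : ∀ A B C D A' B1 B2 C' D' : ℝ, A = A' → B = B1 + B2 → C = C' → D = D' →
      A + B + C + D = A' + (B1 + B2 + (C' + D')) := by
    intros; subst_vars; ring
  apply key
  · refine Finset.sum_congr rfl fun i _ => Finset.sum_congr rfl fun j _ => ?_
    rw [h1', show lam / (n : ℝ) * _ = √(lam / n) ^ 2 * _ from by rw [← h1]]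
    ring
  · rw [← Finset.sum_add_distrib]
    refine Finset.sum_congr rfl fun i _ => ?_
    linear_combination ((ec x).1 i * (ec ω.1).1 i - (ec x).1 i ^ 2 / 2) * h2
      + ((ec x).2 i * (ec ω.1).2 i - (ec x).2 i ^ 2 / 2) * h3
  · refine Finset.sum_congr rfl fun i _ => ?_
    linear_combination (au ^ 2 * ((ec x).1 i * (ec ω.1).1 i - (ec x).1 i ^ 2 / 2)) * h4
  · refine Finset.sum_congr rfl fun i _ => ?_
    linear_combination (av ^ 2 * ((ec x).2 i * (ec ω.1).2 i - (ec x).2 i ^ 2 / 2)) * h4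

theorem ec_emb (S : Finset ℝ) (n : ℕ) : MeasurableEmbedding (ec (S := S) (n := n)) where
  injective := by
    intro x x' h
    unfold ec at h
    rw [Prod.mk.injEq] at h
    refine Prod.ext ?_ ?_
    · ext i; exact congrFun h.1 i
    · ext i; exact congrFun h.2 i
  measurable := Measurable.of_discrete
  measurableSet_image' := fun s _ => (Set.toFinite _).measurableSet

theorem prior_integral (S : Finset ℝ) (PU PV : Measure ℝ) [IsProbabilityMeasure PU]
    [IsProbabilityMeasure PV] (hU : PU ((↑S : Set ℝ)ᶜ) = 0) (hV : PV ((↑S : Set ℝ)ᶜ) = 0)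
    (n : ℕ) (g : (Fin n → ℝ) × (Fin n → ℝ) → ℝ) :
    ∫ uv, g uv ∂(prior PU PV n) = ∑ x, pwt (nuS S PU PV n) x * g (ec x) := by
  have := nuS_prob S PU PV hU hV n
  rw [← (ec_mp S PU PV hU hV n).integral_comp (ec_emb S n), pwt_integral]

theorem gibbsTot_eq (S : Finset ℝ) (PU PV : Measure ℝ) [IsProbabilityMeasure PU]
    [IsProbabilityMeasure PV] (hU : PU ((↑S : Set ℝ)ᶜ) = 0) (hV : PV ((↑S : Set ℝ)ᶜ) = 0)
    (lam qu qv : ℝ) (n : ℕ) (au av : ℝ) (ω) (f : (Fin n → ℝ) × (Fin n → ℝ) → ℝ) :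
    gibbsTot PU PV lam qu qv n au av ω f = gb (pwt (nuS S PU PV n))
      (fun x => HamTot lam qu qv n au av ω (ec x).1 (ec x).2) (fun x => f (ec x)) := by
  unfold gibbsTot gb Zn
  rw [prior_integral S PU PV hU hV, prior_integral S PU PV hU hV]
  congr 1
  refine Finset.sum_congr rfl fun x _ => by ring

theorem sample_integral (S : Finset ℝ) (PU PV : Measure ℝ) [IsProbabilityMeasure PU]
    [IsProbabilityMeasure PV] (hU : PU ((↑S : Set ℝ)ᶜ) = 0) (hV : PV ((↑S : Set ℝ)ᶜ) = 0)
    (lam qu qv : ℝ) (hlam : 0 < lam) (hqu : 0 ≤ qu) (hqv : 0 ≤ qv) (n : ℕ) (au av : ℝ)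
    (φ : (Fin n → ℝ) × (Fin n → ℝ) → (Fin n → ℝ) × (Fin n → ℝ) → ℝ) :
    ∫ ω, gibbsTot PU PV lam qu qv n au av ω (fun uv1 => gibbsTot PU PV lam qu qv n au av ω
        (fun uv2 => φ uv1 uv2)) ∂(sampleP PU PV n)
      = ∫ ω, gb (pwt (nuS S PU PV n)) (HT (TX S lam qu qv n au av) ω)
          (fun x1 => gb (pwt (nuS S PU PV n)) (HT (TX S lam qu qv n au av) ω)
            (fun x2 => φ (ec x1) (ec x2))) ∂((nuS S PU PV n).prod (gam (IS n))) := by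
  simp_rw [gibbsTot_eq S PU PV hU hV]
  rw [← (flatS_mp S PU PV hU hV n).map_eq, integral_map (flatS_mp S PU PV hU hV n).measurable.aemeasurable]
  · simp_rw [HamTot_flat S lam qu qv hlam hqu hqv]
  · have hm : ∀ x : XS S n, Measurable fun ω => HamTot lam qu qv n au av ω (ec x).1 (ec x).2 := by
      intro x
      unfold HamTot Ham
      fun_prop
    refine Measurable.aestronglyMeasurable ?_
    exact measurable_gb _ _ _ hm fun x1 => measurable_gb _ _ (fun _ x2 => φ (ec x1) (ec x2)) hm
      (fun _ => measurable_const)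

/-- First perturbation channel. -/
def yU (S : Finset ℝ) (n : ℕ) (x : XS S n) : IS n → ℝ
  | Sum.inr (Sum.inr (Sum.inl i)) => (ec x).1 i
  | _ => 0

/-- Second perturbation channel. -/
def yV (S : Finset ℝ) (n : ℕ) (x : XS S n) : IS n → ℝ
  | Sum.inr (Sum.inr (Sum.inr i)) => (ec x).2 i
  | _ => 0

theorem TX_U (S : Finset ℝ) (lam qu qv : ℝ) (n : ℕ) (au av : ℝ) :
    TX S lam qu qv n au av = Tch (TX S lam qu qv n 0 av) (yU S n) (√(sSeq n)) au := by
  funext x k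
  rcases k with ij | (i | i) | (i | i) <;> simp [TX, Tch, Traw, yU]

theorem TX_V (S : Finset ℝ) (lam qu qv : ℝ) (n : ℕ) (au av : ℝ) :
    TX S lam qu qv n au av = Tch (TX S lam qu qv n au 0) (yV S n) (√(sSeq n)) av := by
  funext x k
  rcases k with ij | (i | i) | (i | i) <;> simp [TX, Tch, Traw, yV]

theorem yU_T (S : Finset ℝ) (lam qu qv : ℝ) (n : ℕ) (av : ℝ) (x x' : XS S n) (k : IS n) :
    yU S n x k * TX S lam qu qv n 0 av x' k = 0 := by
  rcases k with ij | (i | i) | (i | i) <;> simp [TX, Traw, yU]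

theorem yV_T (S : Finset ℝ) (lam qu qv : ℝ) (n : ℕ) (au : ℝ) (x x' : XS S n) (k : IS n) :
    yV S n x k * TX S lam qu qv n au 0 x' k = 0 := by
  rcases k with ij | (i | i) | (i | i) <;> simp [TX, Traw, yV]

theorem Rov_U (S : Finset ℝ) (n : ℕ) (x x' : XS S n) :
    Rov (yU S n) n x x' = ovDot n (ec x).1 (ec x').1 := by
  simp [Rov, ovDot, yU, Fintype.sum_sum_type]

theorem Rov_V (S : Finset ℝ) (n : ℕ) (x x' : XS S n) :
    Rov (yV S n) n x x' = ovDot n (ec x).2 (ec x').2 := by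
  simp [Rov, ovDot, yV, Fintype.sum_sum_type]

theorem sq_bd {K x : ℝ} (h : |x| ≤ K) : x ^ 2 ≤ K ^ 2 := by
  rw [← sq_abs]; exact pow_le_pow_left₀ (abs_nonneg _) h 2

theorem yU_sq (S : Finset ℝ) (K : ℝ) (hS : ∀ x ∈ S, |x| ≤ K) (n : ℕ) (x : XS S n) :
    ∑ k, yU S n x k ^ 2 ≤ n * K ^ 2 := by
  simp only [Fintype.sum_sum_type, yU]
  simp only [ne_eq, OfNat.ofNat_ne_zero, not_false_eq_true, zero_pow, Finset.sum_const_zero,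
    zero_add, add_zero]
  refine (Finset.sum_le_card_nsmul _ _ (K ^ 2) fun i _ => ?_).trans (by simp)
  exact sq_bd (hS _ (x.1 i).2)

theorem yV_sq (S : Finset ℝ) (K : ℝ) (hS : ∀ x ∈ S, |x| ≤ K) (n : ℕ) (x : XS S n) :
    ∑ k, yV S n x k ^ 2 ≤ n * K ^ 2 := by
  simp only [Fintype.sum_sum_type, yV]
  simp only [ne_eq, OfNat.ofNat_ne_zero, not_false_eq_true, zero_pow, Finset.sum_const_zero,
    zero_add, add_zero]
  refine (Finset.sum_le_card_nsmul _ _ (K ^ 2) fun i _ => ?_).trans (by simp)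
  exact sq_bd (hS _ (x.2 i).2)

end redSec



section feSec

/-- Truncation. -/
def cl (K r : ℝ) : ℝ := max (-K) (min r K)

theorem cl_abs (K r : ℝ) (hK : 0 ≤ K) : |cl K r| ≤ K := by
  unfold cl
  rw [abs_le]
  exact ⟨le_max_left _ _, max_le (by linarith) (min_le_right _ _)⟩

theorem cl_eq (K r : ℝ) (h : |r| ≤ K) : cl K r = r := by
  unfold cl
  rw [abs_le] at h
  rw [min_eq_left h.2, max_eq_right h.1]

theorem cl_lip (K r r' : ℝ) : |cl K r - cl K r'| ≤ |r - r'| := by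
  unfold cl
  rw [max_comm (-K), max_comm (-K)]
  refine (abs_max_sub_max_le_abs (min r K) (min r' K) (-K)).trans ?_
  have h := abs_min_sub_min_le_max r K r' K
  simpa using h

theorem cl_meas (K : ℝ) : Measurable (cl K) := by unfold cl; fun_prop

theorem hN_diff {X ι : Type*} [Fintype ι] (T : X → ι → ℝ) (Y Y' : ι → ℝ) (x : X) :
    hN T Y' x - hN T Y x = ∑ k, T x k * (Y' k - Y k) := by
  unfold hN
  rw [← Finset.sum_sub_distrib]
  exact Finset.sum_congr rfl fun k _ => by ring

/-- Lipschitz constant. -/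
def C0f (K lam qu qv A : ℝ) : ℝ :=
  lam * K ^ 3 + lam * qu * K + lam * qv * K + √(lam * qu) * K + √(lam * qv) * K + (A ^ 2 + A) * K

theorem sSeq_le_one (n : ℕ) (hn : 1 ≤ n) : sSeq n ≤ 1 := by
  unfold sSeq
  exact Real.rpow_le_one_of_one_le_of_nonpos (by exact_mod_cast hn) (by norm_num)

section
variable {K lam qu qv A : ℝ} (hK : 0 ≤ K) (hlam : 0 < lam) (hqu : 0 ≤ qu) (hqv : 0 ≤ qv)
  (hA : 0 ≤ A) {n : ℕ} (hn : 1 ≤ n) {au av : ℝ} (hau : |au| ≤ A) (hav : |av| ≤ A)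

theorem avg_dot_bd (hK : 0 ≤ K) (hlam : 0 < lam) (hn : 1 ≤ n) (v V : Fin n → ℝ)
    (hv : ∀ i, |v i| ≤ K) (hV : ∀ i, |V i| ≤ K) :
    |√(lam / n) ^ 2 * ∑ j, v j * V j| ≤ lam * K ^ 2 := by
  have hn' : (0 : ℝ) < n := by exact_mod_cast hn
  rw [Real.sq_sqrt (by positivity), abs_mul, abs_of_nonneg (by positivity)]
  have : |∑ j, v j * V j| ≤ n * K ^ 2 := by
    refine (Finset.abs_sum_le_sum_abs _ _).trans ?_
    refine (Finset.sum_le_card_nsmul _ _ (K ^ 2) fun i _ => ?_).trans (by simp)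
    rw [abs_mul, sq]
    exact mul_le_mul (hv i) (hV i) (abs_nonneg _) hK
  calc lam / n * |∑ j, v j * V j| ≤ lam / n * (n * K ^ 2) :=
        mul_le_mul_of_nonneg_left this (by positivity)
    _ = lam * K ^ 2 := by field_simp

theorem coef_bd (hK : 0 ≤ K) (hlam : 0 < lam) (hqu : 0 ≤ qu) (hqv : 0 ≤ qv) (hA : 0 ≤ A)
    (hn : 1 ≤ n) {a w q d : ℝ} (hq : 0 ≤ q) (hq' : q ≤ qu + qv) (ha : |a| ≤ A) (hw : |w| ≤ K)
    (hd : |d| ≤ lam * K ^ 2) :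
    |w * (d + √(lam * q) ^ 2 + (a * √(sSeq n)) ^ 2)| ≤ C0f K lam qu qv A := by
  have h1 : |d + √(lam * q) ^ 2 + (a * √(sSeq n)) ^ 2| ≤ lam * K ^ 2 + lam * (qu + qv) + A ^ 2 := by
    rw [mul_pow, Real.sq_sqrt (by positivity), Real.sq_sqrt (sSeq_nonneg n)]
    have e1 : a ^ 2 ≤ A ^ 2 := sq_bd ha
    have e2 : a ^ 2 * sSeq n ≤ A ^ 2 := by
      calc a ^ 2 * sSeq n ≤ a ^ 2 * 1 :=
            mul_le_mul_of_nonneg_left (sSeq_le_one n hn) (sq_nonneg _)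
        _ ≤ A ^ 2 := by linarith
    have e3 : 0 ≤ a ^ 2 * sSeq n := mul_nonneg (sq_nonneg _) (sSeq_nonneg n)
    have e4 : 0 ≤ lam * q := by positivity
    have e5 : lam * q ≤ lam * (qu + qv) := mul_le_mul_of_nonneg_left hq' hlam.le
    rw [abs_le] at hd ⊢
    constructor <;> linarith [hd.1, hd.2, sq_nonneg A]
  rw [abs_mul]
  have h2 := mul_le_mul hw h1 (abs_nonneg _) hK
  refine h2.trans ?_
  unfold C0f
  have e1 : 0 ≤ √(lam * qu) * K := by positivity
  have e2 : 0 ≤ √(lam * qv) * K := by positivity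
  have e3 : 0 ≤ A * K := by positivity
  nlinarith

theorem lip_sum (c : Fin n → ℝ) (C : ℝ) (hc : ∀ i, |c i| ≤ C) (z : Fin n → ℝ) (i : Fin n) (y K : ℝ) :
    |∑ j, (cl K (Function.update z i y j) - cl K (z j)) * c j| ≤ C * |y - z i| := by
  rw [Finset.sum_eq_single i]
  · rw [abs_mul, mul_comm]
    simp only [Function.update_self]
    exact mul_le_mul (hc i) (cl_lip K y (z i)) (abs_nonneg _) ((abs_nonneg _).trans (hc i))
  · intro b _ hb
    simp [Function.update_of_ne hb]
  · simp

end

/-- Flat index set including the signal. -/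
abbrev KS (n : ℕ) : Type := (Fin n ⊕ Fin n) ⊕ IS n

/-- Flat law. -/
def kap (PU PV : Measure ℝ) (n : ℕ) : KS n → Measure ℝ :=
  Sum.elim (Sum.elim (fun _ => PU) (fun _ => PV)) (fun _ => stdG)

/-- Flat observation. -/
def Yc (lam qu qv K : ℝ) (n : ℕ) (au av : ℝ) (z : KS n → ℝ) : IS n → ℝ :=
  Traw lam qu qv n au av (fun i => cl K (z (Sum.inl (Sum.inl i))))
    (fun i => cl K (z (Sum.inl (Sum.inr i)))) + fun k => z (Sum.inr k)

/-- Lipschitz coefficients. -/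
def cK (K lam qu qv A : ℝ) (n : ℕ) : KS n → ℝ
  | Sum.inr (Sum.inl _) => √(lam / n) * K ^ 2
  | _ => C0f K lam qu qv A

theorem Yc_lip (S : Finset ℝ) {K lam qu qv A : ℝ} (hS : ∀ x ∈ S, |x| ≤ K) (hK : 0 ≤ K)
    (hlam : 0 < lam) (hqu : 0 ≤ qu) (hqv : 0 ≤ qv)
    (hA : 0 ≤ A) {n : ℕ} (hn : 1 ≤ n) {au av : ℝ} (hau : |au| ≤ A) (hav : |av| ≤ A)
    (x : XS S n) (z : KS n → ℝ) (k : KS n) (y : ℝ) :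
    |hN (TX S lam qu qv n au av) (Yc lam qu qv K n au av (Function.update z k y)) x
      - hN (TX S lam qu qv n au av) (Yc lam qu qv K n au av z) x|
      ≤ cK K lam qu qv A n k * |y - z k| := by
  have hx1 : ∀ i, |(ec x).1 i| ≤ K := fun i => hS _ (x.1 i).2
  have hx2 : ∀ i, |(ec x).2 i| ≤ K := fun i => hS _ (x.2 i).2
  rw [hN_diff]
  rcases k with (i | i) | k
  · have e : ∑ k, TX S lam qu qv n au av x k *
        (Yc lam qu qv K n au av (Function.update z (Sum.inl (Sum.inl i)) y) k
          - Yc lam qu qv K n au av z k)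
        = ∑ j, (cl K (Function.update (fun i => z (Sum.inl (Sum.inl i))) i y j)
          - cl K ((fun i => z (Sum.inl (Sum.inl i))) j)) * ((ec x).1 j *
          (√(lam / n) ^ 2 * ∑ l, (ec x).2 l * cl K (z (Sum.inl (Sum.inr l)))
            + √(lam * qu) ^ 2 + (au * √(sSeq n)) ^ 2)) := by
      have u1 : ∀ j, Function.update z (Sum.inl (Sum.inl i)) y (Sum.inl (Sum.inl j))
          = Function.update (fun i => z (Sum.inl (Sum.inl i))) i y j := by
        intro j
        by_cases h : j = i
        · subst h; simp
        · simp [Function.update_of_ne, h]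
      have u2 : ∀ j, Function.update z (Sum.inl (Sum.inl i)) y (Sum.inl (Sum.inr j))
          = z (Sum.inl (Sum.inr j)) := by
        intro j; simp
      have u3 : ∀ j, Function.update z (Sum.inl (Sum.inl i)) y (Sum.inr j) = z (Sum.inr j) := by
        intro j; simp
      simp only [Fintype.sum_sum_type, Fintype.sum_prod_type, TX, Yc, Traw, Pi.add_apply, u1, u2, u3,
        sub_self, add_sub_add_right_eq_sub, mul_zero, Finset.sum_const_zero, add_zero]
      rw [← Finset.sum_add_distrib, ← Finset.sum_add_distrib]
      refine Finset.sum_congr rfl fun j _ => ?_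
      rw [mul_add, mul_add, mul_add, mul_add, add_assoc]
      congr 1
      · rw [Finset.mul_sum, Finset.mul_sum, Finset.mul_sum]
        exact Finset.sum_congr rfl fun l _ => by ring
      · ring
    rw [e]
    exact lip_sum _ _ (fun j => coef_bd hK hlam hqu hqv hA hn hqu (by linarith) hau (hx1 j)
      (avg_dot_bd hK hlam hn _ _ hx2 fun l => cl_abs K _ hK)) _ i y K
  · have e : ∑ k, TX S lam qu qv n au av x k *
        (Yc lam qu qv K n au av (Function.update z (Sum.inl (Sum.inr i)) y) k
          - Yc lam qu qv K n au av z k)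
        = ∑ j, (cl K (Function.update (fun i => z (Sum.inl (Sum.inr i))) i y j)
          - cl K ((fun i => z (Sum.inl (Sum.inr i))) j)) * ((ec x).2 j *
          (√(lam / n) ^ 2 * ∑ l, (ec x).1 l * cl K (z (Sum.inl (Sum.inl l)))
            + √(lam * qv) ^ 2 + (av * √(sSeq n)) ^ 2)) := by
      have u1 : ∀ j, Function.update z (Sum.inl (Sum.inr i)) y (Sum.inl (Sum.inr j))
          = Function.update (fun i => z (Sum.inl (Sum.inr i))) i y j := by
        intro j
        by_cases h : j = i
        · subst h; simp
        · simp [Function.update_of_ne, h]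
      have u2 : ∀ j, Function.update z (Sum.inl (Sum.inr i)) y (Sum.inl (Sum.inl j))
          = z (Sum.inl (Sum.inl j)) := by
        intro j; simp
      have u3 : ∀ j, Function.update z (Sum.inl (Sum.inr i)) y (Sum.inr j) = z (Sum.inr j) := by
        intro j; simp
      simp only [Fintype.sum_sum_type, Fintype.sum_prod_type, TX, Yc, Traw, Pi.add_apply, u1, u2, u3,
        sub_self, add_sub_add_right_eq_sub, mul_zero, Finset.sum_const_zero, zero_add]
      rw [Finset.sum_comm, ← Finset.sum_add_distrib, ← Finset.sum_add_distrib]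
      refine Finset.sum_congr rfl fun j _ => ?_
      rw [mul_add, mul_add, mul_add, mul_add, ← add_assoc]
      congr 1
      · congr 1
        · rw [Finset.mul_sum, Finset.mul_sum, Finset.mul_sum]
          exact Finset.sum_congr rfl fun l _ => by ring
        · ring
      · ring
    rw [e]
    exact lip_sum _ _ (fun j => coef_bd hK hlam hqu hqv hA hn hqv (by linarith) hav (hx2 j)
      (avg_dot_bd hK hlam hn _ _ hx1 fun l => cl_abs K _ hK)) _ i y K
  · have e : ∑ k', TX S lam qu qv n au av x k' *
        (Yc lam qu qv K n au av (Function.update z (Sum.inr k) y) k'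
          - Yc lam qu qv K n au av z k') = TX S lam qu qv n au av x k * (y - z (Sum.inr k)) := by
      have u1 : ∀ j, Function.update z (Sum.inr k) y (Sum.inl j) = z (Sum.inl j) := by
        intro j; simp
      rw [Finset.sum_eq_single k]
      · simp [Yc, u1]
      · intro b _ hb
        simp [Yc, u1, hb]
      · simp
    rw [e, abs_mul]
    refine mul_le_mul_of_nonneg_right ?_ (abs_nonneg _)
    have p1 : 0 ≤ lam * K ^ 3 := by positivity
    have p2 : 0 ≤ lam * qu * K := by positivity
    have p3 : 0 ≤ lam * qv * K := by positivity
    have p4 : 0 ≤ √(lam * qu) * K := by positivity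
    have p5 : 0 ≤ √(lam * qv) * K := by positivity
    have p6 : 0 ≤ (A ^ 2 + A) * K := by positivity
    have p7 : 0 ≤ A ^ 2 * K := by positivity
    have ps : √(sSeq n) ≤ 1 := Real.sqrt_le_one.2 (sSeq_le_one n hn)
    have pert : ∀ a w : ℝ, |a| ≤ A → |w| ≤ K → |a * √(sSeq n) * w| ≤ A * K := by
      intro a w ha hw
      rw [abs_mul, abs_mul, abs_of_nonneg (Real.sqrt_nonneg _)]
      refine mul_le_mul ?_ hw (abs_nonneg _) hA
      calc |a| * √(sSeq n) ≤ A * 1 := mul_le_mul ha ps (Real.sqrt_nonneg _) hA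
        _ = A := mul_one A
    have side : ∀ q w : ℝ, |w| ≤ K → |√q * w| ≤ √q * K := by
      intro q w hw
      rw [abs_mul, abs_of_nonneg (Real.sqrt_nonneg _)]
      exact mul_le_mul_of_nonneg_left hw (Real.sqrt_nonneg _)
    rcases k with ij | (i | i) | (i | i)
    · simp only [TX, Traw, cK]
      rw [abs_mul, abs_mul, abs_of_nonneg (Real.sqrt_nonneg _), mul_assoc, sq]
      exact mul_le_mul_of_nonneg_left (mul_le_mul (hx1 _) (hx2 _) (abs_nonneg _) hK)
        (Real.sqrt_nonneg _)
    · simp only [TX, Traw, cK, C0f]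
      linarith [side (lam * qu) _ (hx1 i)]
    · simp only [TX, Traw, cK, C0f]
      linarith [side (lam * qv) _ (hx2 i)]
    · simp only [TX, Traw, cK, C0f]
      linarith [pert au _ hau (hx1 i)]
    · simp only [TX, Traw, cK, C0f]
      linarith [pert av _ hav (hx2 i)]

end feSec



section feSec2

theorem P_memLp (S : Finset ℝ) (P : Measure ℝ) [IsProbabilityMeasure P] {K : ℝ}
    (hS : ∀ x ∈ S, |x| ≤ K) (h : P ((↑S : Set ℝ)ᶜ) = 0) :
    MemLp (fun x : ℝ => x) 2 P ∧ ∫ x, x ^ 2 ∂P ≤ K ^ 2 := by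
  have hae : ∀ᵐ x ∂P, |x| ≤ K := by
    have : ∀ᵐ x ∂P, x ∈ (↑S : Set ℝ) := h
    filter_upwards [this] with x hx using hS x hx
  have h1 : MemLp (fun x : ℝ => x) 2 P := by
    refine MemLp.of_bound measurable_id.aestronglyMeasurable K ?_
    filter_upwards [hae] with x hx using hx
  refine ⟨h1, ?_⟩
  calc ∫ x, x ^ 2 ∂P ≤ ∫ x, K ^ 2 ∂P := by
        refine integral_mono_ae h1.integrable_sq (integrable_const _) ?_
        filter_upwards [hae] with x hx using sq_bd hx
    _ = K ^ 2 := by simp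

/-- Flattening of signal and noise. -/
def Phi {S : Finset ℝ} {n : ℕ} (ω : XS S n × (IS n → ℝ)) : KS n → ℝ :=
  Sum.elim (Sum.elim (ec ω.1).1 (ec ω.1).2) ω.2

theorem kap_prob (PU PV : Measure ℝ) [IsProbabilityMeasure PU] [IsProbabilityMeasure PV] (n : ℕ)
    (k : KS n) : IsProbabilityMeasure (kap PU PV n k) := by
  rcases k with (i | i) | k <;> simp only [kap, Sum.elim_inl, Sum.elim_inr] <;>
    first | infer_instance | (unfold stdG; infer_instance)

theorem Phi_mp (S : Finset ℝ) (PU PV : Measure ℝ) [IsProbabilityMeasure PU]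
    [IsProbabilityMeasure PV] (hU : PU ((↑S : Set ℝ)ᶜ) = 0) (hV : PV ((↑S : Set ℝ)ᶜ) = 0)
    (n : ℕ) : MeasurePreserving (Phi (S := S) (n := n)) ((nuS S PU PV n).prod (gam (IS n)))
      (Measure.pi (kap PU PV n)) := by
  have := nuS_prob S PU PV hU hV n
  have := kap_prob PU PV n
  have hp : IsProbabilityMeasure (prior PU PV n) := by unfold prior; infer_instance
  have m1 := mp_join (Fin n) (Fin n) (fun k => kap PU PV n (Sum.inl k))
  have m2 := m1.comp (ec_mp S PU PV hU hV n)
  have m3 := m2.prod (MeasurePreserving.id (gam (IS n)))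
  exact (mp_join (Fin n ⊕ Fin n) (IS n) (kap PU PV n)).comp m3

/-- Variance proxy. -/
def Cvf (K lam qu qv A : ℝ) : ℝ :=
  2 * (C0f K lam qu qv A ^ 2 * K ^ 2) + lam * K ^ 4 + 4 * C0f K lam qu qv A ^ 2

theorem Yc_meas (lam qu qv K : ℝ) (n : ℕ) (au av : ℝ) (k : IS n) :
    Measurable fun z => Yc lam qu qv K n au av z k := by
  have := cl_meas K
  rcases k with ij | (i | i) | (i | i) <;> simp only [Yc, Traw, Pi.add_apply] <;> fun_prop

theorem fe_conc (S : Finset ℝ) (PU PV : Measure ℝ) [IsProbabilityMeasure PU]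
    [IsProbabilityMeasure PV] (hU : PU ((↑S : Set ℝ)ᶜ) = 0) (hV : PV ((↑S : Set ℝ)ᶜ) = 0)
    {K lam qu qv A : ℝ} (hS : ∀ x ∈ S, |x| ≤ K) (hK : 0 ≤ K)
    (hlam : 0 < lam) (hqu : 0 ≤ qu) (hqv : 0 ≤ qv)
    (hA : 0 ≤ A) {n : ℕ} (hn : 1 ≤ n) {au av : ℝ} (hau : |au| ≤ A) (hav : |av| ≤ A) :
    Integrable (fun ω => log (Zn (pwt (nuS S PU PV n)) (HT (TX S lam qu qv n au av) ω)))
      ((nuS S PU PV n).prod (gam (IS n))) ∧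
    ∫ ω, |log (Zn (pwt (nuS S PU PV n)) (HT (TX S lam qu qv n au av) ω))
      - ∫ ω, log (Zn (pwt (nuS S PU PV n)) (HT (TX S lam qu qv n au av) ω))
        ∂((nuS S PU PV n).prod (gam (IS n)))| ∂((nuS S PU PV n).prod (gam (IS n)))
      ≤ √(n * Cvf K lam qu qv A) := by
  classical
  have := nuS_prob S PU PV hU hV n
  have := kap_prob PU PV n
  have hmp := Phi_mp S PU PV hU hV n
  let Lc : (KS n → ℝ) → ℝ := fun z => log (Zn (pwt (nuS S PU PV n))
    (fun x => hN (TX S lam qu qv n au av) (Yc lam qu qv K n au av z) x))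
  have hL : ∀ ω : XS S n × (IS n → ℝ),
      log (Zn (pwt (nuS S PU PV n)) (HT (TX S lam qu qv n au av) ω)) = Lc (Phi ω) := by
    intro ω
    have e : Yc lam qu qv K n au av (Phi ω) = TX S lam qu qv n au av ω.1 + ω.2 := by
      unfold Yc Phi TX
      simp only [Sum.elim_inl, Sum.elim_inr]
      congr 2
      · funext i; exact cl_eq K _ (hS _ (ω.1.1 i).2)
      · funext i; exact cl_eq K _ (hS _ (ω.1.2 i).2)
    simp only [Lc, e]
    rfl
  have hm : Measurable Lc := by
    refine Real.measurable_log.comp (measurable_Zn _ _ fun x => ?_)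
    have := Yc_meas lam qu qv K n au av
    unfold hN
    fun_prop
  have hlip : ∀ z k y, |Lc (Function.update z k y) - Lc z| ≤ cK K lam qu qv A n k * |y - z k| := by
    intro z k y
    exact logZ_lip (pwt_nonneg _) (pwt_sum _) _ _ _
      (fun x => Yc_lip S hS hK hlam hqu hqv hA hn hau hav x z k y)
  have hmu : ∀ k, MemLp (fun x : ℝ => x) 2 (kap PU PV n k) := by
    rintro ((i | i) | k)
    · exact (P_memLp S PU hS hU).1
    · exact (P_memLp S PV hS hV).1
    · exact stdG_memLp
  have h2 := coordLip_memLp (kap PU PV n) hmu Lc hm _ hlip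
  have hES := efronStein (kap PU PV n) hmu Lc hm _ hlip
  have hn' : (0 : ℝ) < n := by exact_mod_cast hn
  have hsum : ∑ k, cK K lam qu qv A n k ^ 2 * ∫ x, x ^ 2 ∂(kap PU PV n k)
      ≤ n * Cvf K lam qu qv A := by
    simp only [Fintype.sum_sum_type, Fintype.sum_prod_type, kap, cK, Sum.elim_inl, Sum.elim_inr,
      stdG_sq, Finset.sum_const, Finset.card_univ, Fintype.card_fin, nsmul_eq_mul, mul_one,
      Fintype.card_prod, Fintype.card_sum]
    push_cast
    have e1 := (P_memLp S PU hS hU).2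
    have e2 := (P_memLp S PV hS hV).2
    have e3 : (√(lam / n) * K ^ 2) ^ 2 = lam / n * K ^ 4 := by
      rw [mul_pow, Real.sq_sqrt (by positivity)]; ring
    have e4 : (n : ℝ) * n * (lam / n * K ^ 4) = n * (lam * K ^ 4) := by field_simp
    rw [e3, e4]
    have f1 := mul_le_mul_of_nonneg_left e1 (sq_nonneg (C0f K lam qu qv A))
    have f2 := mul_le_mul_of_nonneg_left e2 (sq_nonneg (C0f K lam qu qv A))
    have g1 := mul_le_mul_of_nonneg_left f1 hn'.le
    have g2 := mul_le_mul_of_nonneg_left f2 hn'.le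
    unfold Cvf
    nlinarith
  have hLc : Integrable Lc (Measure.pi (kap PU PV n)) := h2.integrable (by norm_num)
  have hI : ∫ ω, log (Zn (pwt (nuS S PU PV n)) (HT (TX S lam qu qv n au av) ω))
        ∂((nuS S PU PV n).prod (gam (IS n))) = ∫ z, Lc z ∂(Measure.pi (kap PU PV n)) := by
    simp_rw [hL]
    rw [← hmp.map_eq, integral_map hmp.measurable.aemeasurable hm.aestronglyMeasurable]
  constructor
  · simp_rw [hL]
    exact hmp.integrable_comp_of_integrable hLc
  · rw [hI]
    simp_rw [hL]
    set m := ∫ z, Lc z ∂(Measure.pi (kap PU PV n)) with hmdef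
    have : ∫ ω, |Lc (Phi ω) - m| ∂((nuS S PU PV n).prod (gam (IS n)))
        = ∫ z, |Lc z - m| ∂(Measure.pi (kap PU PV n)) := by
      rw [← hmp.map_eq, integral_map hmp.measurable.aemeasurable]
      exact ((hm.sub_const m).abs).aestronglyMeasurable
    rw [this]
    exact abs_le_sqrt_var _ _ (h2.sub (memLp_const m)) _ (hES.trans hsum)

end feSec2



section intSec

theorem ii_bdd (g : ℝ → ℝ) (hm : Measurable g) (D : ℝ) (hD : ∀ a, |a| ≤ 3 → |g a| ≤ D) (c d : ℝ)
    (hc : 0 ≤ c) (hcd : c ≤ d) (hd : d ≤ 3) : IntervalIntegrable g volume c d := by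
  rw [intervalIntegrable_iff_integrableOn_Ioc_of_le hcd]
  refine Measure.integrableOn_of_bounded (M := D) (by simp) hm.aestronglyMeasurable ?_
  rw [ae_restrict_iff' measurableSet_Ioc]
  refine ae_of_all _ fun a ha => hD a ?_
  rw [abs_le]
  exact ⟨by linarith [ha.1], by linarith [ha.2]⟩

theorem shift_int (g : ℝ → ℝ) (hm : Measurable g) (D t : ℝ) (hD : ∀ a, |a| ≤ 3 → |g a| ≤ D)
    (ht : 0 < t) (ht1 : t ≤ 1) :
    IntervalIntegrable (fun a => g (a + t)) volume 1 2 ∧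
    IntervalIntegrable (fun a => g (a - t)) volume 1 2 ∧
    ∫ a in (1 : ℝ)..2, (g (a + t) - g (a - t)) ≤ 4 * t * D := by
  have i1 : IntervalIntegrable (fun a => g (a + t)) volume 1 2 := by
    have := (ii_bdd g hm D hD (1 + t) (2 + t) (by linarith) (by linarith) (by linarith)).comp_add_right t
    simpa using this
  have i2 : IntervalIntegrable (fun a => g (a - t)) volume 1 2 := by
    have := (ii_bdd g hm D hD (1 - t) (2 - t) (by linarith) (by linarith) (by linarith)).comp_sub_right t
    simpa using this
  refine ⟨i1, i2, ?_⟩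
  rw [intervalIntegral.integral_sub i1 i2, intervalIntegral.integral_comp_add_right,
    intervalIntegral.integral_comp_sub_right]
  have j1 := ii_bdd g hm D hD (1 - t) (1 + t) (by linarith) (by linarith) (by linarith)
  have j2 := ii_bdd g hm D hD (1 + t) (2 + t) (by linarith) (by linarith) (by linarith)
  have j3 := ii_bdd g hm D hD (1 - t) (2 - t) (by linarith) (by linarith) (by linarith)
  have j4 := ii_bdd g hm D hD (2 - t) (2 + t) (by linarith) (by linarith) (by linarith)
  have e1 := intervalIntegral.integral_add_adjacent_intervals j1 j2
  have e2 := intervalIntegral.integral_add_adjacent_intervals j3 j4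
  have bd : ∀ c d : ℝ, 0 ≤ c → c ≤ d → d ≤ 3 → |∫ x in c..d, g x| ≤ D * (d - c) := by
    intro c d hc hcd hd
    have := intervalIntegral.norm_integral_le_of_norm_le_const (a := c) (b := d) (f := g) (C := D)
      (fun x hx => by
        rw [Set.uIoc_of_le hcd] at hx
        exact hD x (abs_le.2 ⟨by linarith [hx.1], by linarith [hx.2]⟩))
    rwa [abs_of_nonneg (by linarith : (0 : ℝ) ≤ d - c)] at this
  have b1 := abs_le.1 (bd (1 - t) (1 + t) (by linarith) (by linarith) (by linarith))
  have b2 := abs_le.1 (bd (2 - t) (2 + t) (by linarith) (by linarith) (by linarith))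
  have := b1.1
  have := b2.2
  nlinarith

theorem ii_mono (f g : ℝ → ℝ) (hf : ∀ a, 0 ≤ f a) (hg : IntervalIntegrable g volume 1 2)
    (h : ∀ a, 1 ≤ a → a ≤ 2 → f a ≤ g a) : ∫ a in (1 : ℝ)..2, f a ≤ ∫ a in (1 : ℝ)..2, g a := by
  rw [intervalIntegral.integral_of_le (by norm_num), intervalIntegral.integral_of_le (by norm_num)]
  refine integral_mono_of_nonneg (ae_of_all _ hf)
    ((intervalIntegrable_iff_integrableOn_Ioc_of_le (by norm_num)).1 hg) ?_
  refine (ae_restrict_iff' measurableSet_Ioc).2 (ae_of_all _ fun a ha => h a ha.1.le ha.2)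

theorem ii_nonneg (f : ℝ → ℝ) (hf : ∀ a, 0 ≤ f a) : 0 ≤ ∫ a in (1 : ℝ)..2, f a :=
  intervalIntegral.integral_nonneg (by norm_num) fun a _ => hf a

theorem one_dim (f g : ℝ → ℝ) (hm : Measurable g) (c c2 D t : ℝ) (hc2 : 0 ≤ c2)
    (hD : ∀ a, |a| ≤ 3 → |g a| ≤ D) (ht : 0 < t) (ht1 : t ≤ 1) (hf : ∀ a, 0 ≤ f a)
    (h : ∀ a, 1 ≤ a → a ≤ 2 → f a ≤ c + c2 * (g (a + t) - g (a - t))) :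
    ∫ a in (1 : ℝ)..2, f a ≤ c + c2 * (4 * t * D) := by
  obtain ⟨i1, i2, i3⟩ := shift_int g hm D t hD ht ht1
  have i4 := ((i1.sub i2).const_mul c2)
  refine (ii_mono f _ hf ((intervalIntegrable_const (c := c)).add i4) h).trans ?_
  rw [intervalIntegral.integral_add intervalIntegrable_const i4, intervalIntegral.integral_const_mul]
  simp only [intervalIntegral.integral_const, smul_eq_mul]
  have := mul_le_mul_of_nonneg_left i3 hc2
  linarith

theorem two_dim_V (F P : ℝ → ℝ → ℝ) (hm : ∀ a, Measurable (P a)) (c c2 D t : ℝ) (hc2 : 0 ≤ c2)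
    (hD : ∀ a b, |a| ≤ 3 → |b| ≤ 3 → |P a b| ≤ D) (ht : 0 < t) (ht1 : t ≤ 1) (hF : ∀ a b, 0 ≤ F a b)
    (h : ∀ a b, 1 ≤ a → a ≤ 2 → 1 ≤ b → b ≤ 2 → F a b ≤ c + c2 * (P a (b + t) - P a (b - t))) :
    ∫ a in (1 : ℝ)..2, ∫ b in (1 : ℝ)..2, F a b ≤ c + c2 * (4 * t * D) := by
  refine (ii_mono _ (fun _ => c + c2 * (4 * t * D)) (fun a => ii_nonneg _ (hF a))
    intervalIntegrable_const fun a h1 h2 => ?_).trans ?_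
  · exact one_dim (F a) (P a) (hm a) c c2 D t hc2
      (fun b hb => hD a b (abs_le.2 ⟨by linarith, by linarith⟩) hb) ht ht1 (hF a)
      fun b hb1 hb2 => h a b h1 h2 hb1 hb2
  · simp only [intervalIntegral.integral_const, smul_eq_mul]
    linarith

theorem two_dim_U (F P : ℝ → ℝ → ℝ) (hm : Measurable fun p : ℝ × ℝ => P p.1 p.2)
    (c c2 D t : ℝ) (hc2 : 0 ≤ c2)
    (hD : ∀ a b, |a| ≤ 3 → |b| ≤ 3 → |P a b| ≤ D) (ht : 0 < t) (ht1 : t ≤ 1) (hF : ∀ a b, 0 ≤ F a b)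
    (h : ∀ a b, 1 ≤ a → a ≤ 2 → 1 ≤ b → b ≤ 2 → F a b ≤ c + c2 * (P (a + t) b - P (a - t) b)) :
    ∫ a in (1 : ℝ)..2, ∫ b in (1 : ℝ)..2, F a b ≤ c + c2 * (4 * t * D) := by
  have hmb : ∀ a, Measurable (P a) := fun a => hm.comp measurable_prodMk_left
  have hPi : ∀ a, |a| ≤ 3 → IntervalIntegrable (P a) volume 1 2 := fun a ha =>
    ii_bdd (P a) (hmb a) D (fun b hb => hD a b ha hb) 1 2 (by norm_num) (by norm_num) (by norm_num)
  refine one_dim _ (fun a => ∫ b in (1 : ℝ)..2, P a b) ?_ c c2 D t hc2 ?_ ht ht1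
    (fun a => ii_nonneg _ (hF a)) ?_
  · simp_rw [intervalIntegral.integral_of_le (show (1 : ℝ) ≤ 2 by norm_num)]
    exact (hm.stronglyMeasurable.integral_prod_right (ν := volume.restrict (Set.Ioc (1 : ℝ) 2))).measurable
  · intro a ha
    have := intervalIntegral.norm_integral_le_of_norm_le_const (a := 1) (b := 2) (f := P a) (C := D)
      (fun x hx => by
        rw [Set.uIoc_of_le (by norm_num)] at hx
        exact hD a x ha (abs_le.2 ⟨by linarith [hx.1], by linarith [hx.2]⟩))
    norm_num at this
    exact this
  · intro a h1 h2
    have i1 := hPi (a + t) (abs_le.2 ⟨by linarith, by linarith⟩)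
    have i2 := hPi (a - t) (abs_le.2 ⟨by linarith, by linarith⟩)
    have i4 := ((i1.sub i2).const_mul c2)
    refine (ii_mono _ _ (hF a) ((intervalIntegrable_const (c := c)).add i4)
      fun b hb1 hb2 => h a b h1 h2 hb1 hb2).trans ?_
    rw [intervalIntegral.integral_add intervalIntegrable_const i4,
      intervalIntegral.integral_const_mul, intervalIntegral.integral_sub i1 i2]
    simp only [intervalIntegral.integral_const, smul_eq_mul]
    linarith

end intSec



section asmSec

theorem TX_meas (S : Finset ℝ) (lam qu qv : ℝ) (n : ℕ) (x : XS S n) (k : IS n) :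
    Measurable fun p : ℝ × ℝ => TX S lam qu qv n p.1 p.2 x k := by
  rcases k with ij | (i | i) | (i | i) <;> simp only [TX, Traw] <;> fun_prop

theorem Pfam_meas (S : Finset ℝ) (PU PV : Measure ℝ) [IsProbabilityMeasure PU]
    [IsProbabilityMeasure PV] (hU : PU ((↑S : Set ℝ)ᶜ) = 0) (hV : PV ((↑S : Set ℝ)ᶜ) = 0)
    (lam qu qv : ℝ) (n : ℕ) (y : XS S n → IS n → ℝ) (σ N : ℝ) (α : ℝ × ℝ → ℝ) (hα : Measurable α) :
    Measurable fun p : ℝ × ℝ => ∫ ω, gb (pwt (nuS S PU PV n)) (HT (TX S lam qu qv n p.1 p.2) ω)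
      (Uf y σ N (α p) ω) ∂((nuS S PU PV n).prod (gam (IS n))) := by
  have := nuS_prob S PU PV hU hV n
  have hsw : ∀ F : (ℝ × ℝ) × (XS S n × (IS n → ℝ)) → ℝ,
      (∀ x₀, Measurable fun q : (ℝ × ℝ) × (IS n → ℝ) => F (q.1, (x₀, q.2))) → Measurable F := by
    intro F hF
    have h1 : Measurable fun r : XS S n × ((ℝ × ℝ) × (IS n → ℝ)) => F (r.2.1, (r.1, r.2.2)) :=
      measX _ hF
    exact h1.comp (g := fun r : XS S n × ((ℝ × ℝ) × (IS n → ℝ)) => F (r.2.1, (r.1, r.2.2)))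
      (f := fun s : (ℝ × ℝ) × (XS S n × (IS n → ℝ)) => (s.2.1, (s.1, s.2.2)))
      (by fun_prop)
  have h := measurable_gb (Ω := (ℝ × ℝ) × (XS S n × (IS n → ℝ))) (pwt (nuS S PU PV n))
    (fun s => HT (TX S lam qu qv n s.1.1 s.1.2) s.2) (fun s => Uf y σ N (α s.1) s.2)
    (fun x => hsw _ fun x₀ => ?_) (fun x => hsw _ fun x₀ => ?_)
  · exact h.stronglyMeasurable.integral_prod_right.measurable
  · have hx := TX_meas S lam qu qv n x
    have hx₀ := TX_meas S lam qu qv n x₀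
    simp only [HT, hN, Pi.add_apply]
    refine Finset.measurable_sum _ fun k _ => ?_
    have h1 : Measurable fun q : (ℝ × ℝ) × (IS n → ℝ) => TX S lam qu qv n q.1.1 q.1.2 x k :=
      (hx k).comp measurable_fst
    have h2 : Measurable fun q : (ℝ × ℝ) × (IS n → ℝ) => TX S lam qu qv n q.1.1 q.1.2 x₀ k :=
      (hx₀ k).comp measurable_fst
    have h3 : Measurable fun q : (ℝ × ℝ) × (IS n → ℝ) => q.2 k := by fun_prop
    exact (h1.mul (h2.add h3)).sub ((h1.pow_const 2).div_const 2)
  · simp only [Uf]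
    fun_prop

/-- Error bound. -/
def epsN (K lam qu qv : ℝ) (n : ℕ) (t : ℝ) : ℝ :=
  2 * K ^ 2 * ((2 * log 2 + 4 * √(n * Cvf K lam qu qv 3)) / (n * √(sSeq n) ^ 2 * t)
    + 4 * (2 * K ^ 2) * t + K / (√(sSeq n) * √n))
  + 2 * K ^ 2 * (4 * t * (3 * K ^ 2 + K / (√(sSeq n) * √n)))

section
variable (S : Finset ℝ) (PU PV : Measure ℝ) [IsProbabilityMeasure PU]
    [IsProbabilityMeasure PV] (hU : PU ((↑S : Set ℝ)ᶜ) = 0) (hV : PV ((↑S : Set ℝ)ᶜ) = 0)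
    {K lam qu qv : ℝ} (hS : ∀ x ∈ S, |x| ≤ K) (hK : 0 ≤ K)
    (hlam : 0 < lam) (hqu : 0 ≤ qu) (hqv : 0 ≤ qv) {n : ℕ} (hn : 1 ≤ n) (t : ℝ)
    (ht : 0 < t) (ht1 : t ≤ 1)

theorem gb2_nonneg {X : Type*} [Fintype X] (p H : X → ℝ) (hp : ∀ x, 0 ≤ p x) (f : X → ℝ)
    (hf : ∀ x, 0 ≤ f x) : 0 ≤ gb p H f := by
  unfold gb Zn
  refine div_nonneg (Finset.sum_nonneg fun x _ => ?_) (Finset.sum_nonneg fun x _ => ?_)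
  · have := hp x; have := hf x; positivity
  · have := hp x; positivity

theorem caseU (hU : PU ((↑S : Set ℝ)ᶜ) = 0) (hV : PV ((↑S : Set ℝ)ᶜ) = 0)
    (hS : ∀ x ∈ S, |x| ≤ K) (hK : 0 ≤ K)
    (hlam : 0 < lam) (hqu : 0 ≤ qu) (hqv : 0 ≤ qv) (hn : 1 ≤ n)
    (ht : 0 < t) (ht1 : t ≤ 1) :
    0 ≤ ∫ au in (1 : ℝ)..2, ∫ av in (1 : ℝ)..2,
          ∫ ω, gibbsTot PU PV lam qu qv n au av ω
              (fun uv1 => gibbsTot PU PV lam qu qv n au av ω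
                (fun uv2 =>
                  (ovDot n uv1.1 uv2.1 - EovU PU PV lam qu qv n au av) ^ 2))
            ∂(sampleP PU PV n) ∧
    ∫ au in (1 : ℝ)..2, ∫ av in (1 : ℝ)..2,
          ∫ ω, gibbsTot PU PV lam qu qv n au av ω
              (fun uv1 => gibbsTot PU PV lam qu qv n au av ω
                (fun uv2 =>
                  (ovDot n uv1.1 uv2.1 - EovU PU PV lam qu qv n au av) ^ 2))
            ∂(sampleP PU PV n) ≤ epsN K lam qu qv n t := by
  have := nuS_prob S PU PV hU hV n
  have hn' : (0 : ℝ) < n := by exact_mod_cast hn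
  have hs : 0 < √(sSeq n) := Real.sqrt_pos.2 (by unfold sSeq; positivity)
  have hF : ∀ au av, 0 ≤ ∫ ω, gibbsTot PU PV lam qu qv n au av ω
              (fun uv1 => gibbsTot PU PV lam qu qv n au av ω
                (fun uv2 =>
                  (ovDot n uv1.1 uv2.1 - EovU PU PV lam qu qv n au av) ^ 2))
            ∂(sampleP PU PV n) := by
    intro au av
    rw [sample_integral S PU PV hU hV lam qu qv hlam hqu hqv]
    exact integral_nonneg fun ω => gb2_nonneg _ _ (pwt_nonneg _) _ fun x =>
      gb2_nonneg _ _ (pwt_nonneg _) _ fun x => sq_nonneg _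
  refine ⟨ii_nonneg _ fun a => ii_nonneg _ (hF a), ?_⟩
  unfold epsN
  refine two_dim_U _ (fun a b => Pf (nuS S PU PV n) (TX S lam qu qv n 0 b) (yU S n) (√(sSeq n)) n a)
    ?_ _ _ _ t (by positivity) ?_ ht ht1 hF ?_
  · simp only [Pf, ← TX_U]
    exact Pfam_meas S PU PV hU hV lam qu qv n (yU S n) _ _ Prod.fst measurable_fst
  · intro a b ha hb
    refine (Pf_abs _ _ _ _ _ K hn' hs hK (yU_T S lam qu qv n b) (yU_sq S K hS n) a).trans ?_
    have := mul_le_mul_of_nonneg_right ha (sq_nonneg K)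
    linarith
  · intro a b ha1 ha2 hb1 hb2
    rw [EovU, sample_integral S PU PV hU hV lam qu qv hlam hqu hqv,
      sample_integral S PU PV hU hV lam qu qv hlam hqu hqv]
    have h := ov_main (nuS S PU PV n) (TX S lam qu qv n 0 b) (yU S n) (√(sSeq n)) n K hn' hs hK
      (yU_T S lam qu qv n b) (yU_sq S K hS n) a ha1 t (√(n * Cvf K lam qu qv 3)) ht
      (fun c => by
        rw [← TX_U]
        exact (fe_conc S PU PV hU hV hS hK hlam hqu hqv (A := max |c| |b|)
          (le_max_of_le_left (abs_nonneg _)) hn (le_max_left _ _) (le_max_right _ _)).1)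
      (fun c hc1 hc2 => by
        rw [← TX_U]
        exact (fe_conc S PU PV hU hV hS hK hlam hqu hqv (A := 3)
          (by norm_num) hn (abs_le.2 ⟨by linarith, by linarith⟩)
            (abs_le.2 ⟨by linarith, by linarith⟩)).2)
    rw [← TX_U] at h
    simp only [Rov_U] at h
    refine h.trans (le_of_eq ?_)
    ring

theorem caseV (hU : PU ((↑S : Set ℝ)ᶜ) = 0) (hV : PV ((↑S : Set ℝ)ᶜ) = 0)
    (hS : ∀ x ∈ S, |x| ≤ K) (hK : 0 ≤ K)
    (hlam : 0 < lam) (hqu : 0 ≤ qu) (hqv : 0 ≤ qv) (hn : 1 ≤ n)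
    (ht : 0 < t) (ht1 : t ≤ 1) :
    0 ≤ ∫ au in (1 : ℝ)..2, ∫ av in (1 : ℝ)..2,
          ∫ ω, gibbsTot PU PV lam qu qv n au av ω
              (fun uv1 => gibbsTot PU PV lam qu qv n au av ω
                (fun uv2 =>
                  (ovDot n uv1.2 uv2.2 - EovV PU PV lam qu qv n au av) ^ 2))
            ∂(sampleP PU PV n) ∧
    ∫ au in (1 : ℝ)..2, ∫ av in (1 : ℝ)..2,
          ∫ ω, gibbsTot PU PV lam qu qv n au av ω
              (fun uv1 => gibbsTot PU PV lam qu qv n au av ω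
                (fun uv2 =>
                  (ovDot n uv1.2 uv2.2 - EovV PU PV lam qu qv n au av) ^ 2))
            ∂(sampleP PU PV n) ≤ epsN K lam qu qv n t := by
  have := nuS_prob S PU PV hU hV n
  have hn' : (0 : ℝ) < n := by exact_mod_cast hn
  have hs : 0 < √(sSeq n) := Real.sqrt_pos.2 (by unfold sSeq; positivity)
  have hF : ∀ au av, 0 ≤ ∫ ω, gibbsTot PU PV lam qu qv n au av ω
              (fun uv1 => gibbsTot PU PV lam qu qv n au av ω
                (fun uv2 =>
                  (ovDot n uv1.2 uv2.2 - EovV PU PV lam qu qv n au av) ^ 2))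
            ∂(sampleP PU PV n) := by
    intro au av
    rw [sample_integral S PU PV hU hV lam qu qv hlam hqu hqv]
    exact integral_nonneg fun ω => gb2_nonneg _ _ (pwt_nonneg _) _ fun x =>
      gb2_nonneg _ _ (pwt_nonneg _) _ fun x => sq_nonneg _
  refine ⟨ii_nonneg _ fun a => ii_nonneg _ (hF a), ?_⟩
  unfold epsN
  refine two_dim_V _ (fun b a => Pf (nuS S PU PV n) (TX S lam qu qv n b 0) (yV S n) (√(sSeq n)) n a)
    ?_ _ _ _ t (by positivity) ?_ ht ht1 hF ?_
  · intro b
    simp only [Pf, ← TX_V]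
    have h1 := Pfam_meas S PU PV hU hV lam qu qv n (yV S n) (√(sSeq n)) n Prod.snd measurable_snd
    have h2 : Measurable fun a : ℝ => ((b, a) : ℝ × ℝ) := measurable_prodMk_left
    have h3 := h1.comp h2
    simp only [Function.comp_def] at h3
    exact h3
  · intro b a hb ha
    refine (Pf_abs _ _ _ _ _ K hn' hs hK (yV_T S lam qu qv n b) (yV_sq S K hS n) a).trans ?_
    have := mul_le_mul_of_nonneg_right ha (sq_nonneg K)
    linarith
  · intro b a hb1 hb2 ha1 ha2
    rw [EovV, sample_integral S PU PV hU hV lam qu qv hlam hqu hqv,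
      sample_integral S PU PV hU hV lam qu qv hlam hqu hqv]
    have h := ov_main (nuS S PU PV n) (TX S lam qu qv n b 0) (yV S n) (√(sSeq n)) n K hn' hs hK
      (yV_T S lam qu qv n b) (yV_sq S K hS n) a ha1 t (√(n * Cvf K lam qu qv 3)) ht
      (fun c => by
        rw [← TX_V]
        exact (fe_conc S PU PV hU hV hS hK hlam hqu hqv (A := max |c| |b|)
          (le_max_of_le_left (abs_nonneg _)) hn (le_max_right _ _) (le_max_left _ _)).1)
      (fun c hc1 hc2 => by
        rw [← TX_V]
        exact (fe_conc S PU PV hU hV hS hK hlam hqu hqv (A := 3)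
          (by norm_num) hn (abs_le.2 ⟨by linarith, by linarith⟩)
            (abs_le.2 ⟨by linarith, by linarith⟩)).2)
    rw [← TX_V] at h
    simp only [Rov_V] at h
    refine h.trans (le_of_eq ?_)
    ring
end

theorem eps_tendsto (K lam qu qv : ℝ) :
    Tendsto (fun n : ℕ => epsN K lam qu qv n ((n : ℝ) ^ (-(1 / 8) : ℝ))) atTop (𝓝 0) := by
  have hp : ∀ c : ℝ, 0 < c → Tendsto (fun n : ℕ => (n : ℝ) ^ (-c)) atTop (𝓝 0) := fun c hc =>
    (tendsto_rpow_neg_atTop hc).comp tendsto_natCast_atTop_atTop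
  have t1 := hp (5 / 8) (by norm_num)
  have t2 := hp (1 / 8) (by norm_num)
  have t3 := hp (3 / 8) (by norm_num)
  set C := √(Cvf K lam qu qv 3)
  have main : Tendsto (fun n : ℕ => 2 * K ^ 2 * ((2 * log 2 * (n : ℝ) ^ (-(5 / 8) : ℝ)
      + 4 * C * (n : ℝ) ^ (-(1 / 8) : ℝ)) + 4 * (2 * K ^ 2) * (n : ℝ) ^ (-(1 / 8) : ℝ)
      + K * (n : ℝ) ^ (-(3 / 8) : ℝ))
      + 2 * K ^ 2 * (4 * (n : ℝ) ^ (-(1 / 8) : ℝ) * (3 * K ^ 2 + K * (n : ℝ) ^ (-(3 / 8) : ℝ))))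
      atTop (𝓝 (2 * K ^ 2 * ((2 * log 2 * 0 + 4 * C * 0) + 4 * (2 * K ^ 2) * 0 + K * 0)
      + 2 * K ^ 2 * (4 * 0 * (3 * K ^ 2 + K * 0)))) := by
    exact ((((t1.const_mul _).add (t2.const_mul _)).add (t2.const_mul _)).add
      (t3.const_mul _)).const_mul _ |>.add (((t2.const_mul 4).mul
        ((t3.const_mul K).const_add _)).const_mul _)
  have z : 2 * K ^ 2 * ((2 * log 2 * 0 + 4 * C * 0) + 4 * (2 * K ^ 2) * 0 + K * 0)
      + 2 * K ^ 2 * (4 * 0 * (3 * K ^ 2 + K * 0)) = 0 := by ring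
  rw [z] at main
  refine main.congr' ?_
  filter_upwards [eventually_ge_atTop 1] with n hn
  have hn' : (0 : ℝ) < n := by exact_mod_cast hn
  unfold epsN
  have r1 : √(sSeq n) * √n = (n : ℝ) ^ (3 / 8 : ℝ) := by
    unfold sSeq
    rw [Real.sqrt_eq_rpow, Real.sqrt_eq_rpow, ← Real.rpow_mul hn'.le, ← Real.rpow_add hn']
    norm_num
  have r2 : (n : ℝ) * √(sSeq n) ^ 2 * (n : ℝ) ^ (-(1 / 8) : ℝ) = (n : ℝ) ^ (5 / 8 : ℝ) := by
    rw [Real.sq_sqrt (sSeq_nonneg n)]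
    unfold sSeq
    nth_rewrite 1 [← Real.rpow_one (n : ℝ)]
    rw [← Real.rpow_add hn', ← Real.rpow_add hn']
    norm_num
  have r3 : √((n : ℝ) * Cvf K lam qu qv 3) = (n : ℝ) ^ (1 / 2 : ℝ) * C := by
    rw [Real.sqrt_mul hn'.le, Real.sqrt_eq_rpow (n : ℝ)]
  rw [r1, r2, r3, div_eq_mul_inv _ ((n : ℝ) ^ (5 / 8 : ℝ)), div_eq_mul_inv K, ← Real.rpow_neg hn'.le,
    ← Real.rpow_neg hn'.le]
  have r4 : (n : ℝ) ^ (-(1 / 8) : ℝ) = (n : ℝ) ^ (1 / 2 : ℝ) * (n : ℝ) ^ (-(5 / 8) : ℝ) := by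
    rw [← Real.rpow_add hn']; norm_num
  rw [show 4 * C * (n : ℝ) ^ (-(1 / 8) : ℝ)
    = 4 * C * ((n : ℝ) ^ (1 / 2 : ℝ) * (n : ℝ) ^ (-(5 / 8) : ℝ)) from by rw [← r4]]
  ring

end asmSec

/-- **Overlap concentration for matrix factorization** in the perturbed bipartite model
with `s_n = n^{-1/4}`. -/
theorem bipartite_overlap_concentration
    (K₀ : ℝ) (S : Finset ℝ) (hSK : ∀ x ∈ S, |x| ≤ K₀)
    (PU PV : Measure ℝ) [IsProbabilityMeasure PU] [IsProbabilityMeasure PV]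
    (hUS : PU ((↑S : Set ℝ)ᶜ) = 0) (hVS : PV ((↑S : Set ℝ)ᶜ) = 0)
    (hUvar : 0 < (∫ x, x ^ 2 ∂PU) - (∫ x, x ∂PU) ^ 2)
    (hVvar : 0 < (∫ x, x ^ 2 ∂PV) - (∫ x, x ∂PV) ^ 2)
    (lam : ℝ) (hlam : 0 < lam) (qu qv : ℝ) (hqu : 0 ≤ qu) (hqv : 0 ≤ qv) :
    Tendsto
      (fun n =>
        ∫ au in (1 : ℝ)..2, ∫ av in (1 : ℝ)..2,
          ∫ ω, gibbsTot PU PV lam qu qv n au av ω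
              (fun uv1 => gibbsTot PU PV lam qu qv n au av ω
                (fun uv2 =>
                  (ovDot n uv1.1 uv2.1 - EovU PU PV lam qu qv n au av) ^ 2))
            ∂(sampleP PU PV n))
      atTop (𝓝 0)
    ∧ Tendsto
      (fun n =>
        ∫ au in (1 : ℝ)..2, ∫ av in (1 : ℝ)..2,
          ∫ ω, gibbsTot PU PV lam qu qv n au av ω
              (fun uv1 => gibbsTot PU PV lam qu qv n au av ω
                (fun uv2 =>
                  (ovDot n uv1.2 uv2.2 - EovV PU PV lam qu qv n au av) ^ 2))
            ∂(sampleP PU PV n))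
      atTop (𝓝 0) := by
  have hS : ∀ x ∈ S, |x| ≤ |K₀| := fun x hx => (hSK x hx).trans (le_abs_self _)
  have he := eps_tendsto |K₀| lam qu qv
  have ht : ∀ n : ℕ, 1 ≤ n → 0 < (n : ℝ) ^ (-(1 / 8) : ℝ) ∧ (n : ℝ) ^ (-(1 / 8) : ℝ) ≤ 1 := by
    intro n hn
    have hn' : (1 : ℝ) ≤ n := by exact_mod_cast hn
    exact ⟨by positivity, Real.rpow_le_one_of_one_le_of_nonpos hn' (by norm_num)⟩
  constructor
  · refine tendsto_of_tendsto_of_tendsto_of_le_of_le' tendsto_const_nhds he ?_ ?_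
    · filter_upwards [eventually_ge_atTop 1] with n hn
      exact (caseU S PU PV _ hUS hVS hS (abs_nonneg _) hlam hqu hqv hn (ht n hn).1 (ht n hn).2).1
    · filter_upwards [eventually_ge_atTop 1] with n hn
      exact (caseU S PU PV _ hUS hVS hS (abs_nonneg _) hlam hqu hqv hn (ht n hn).1 (ht n hn).2).2
  · refine tendsto_of_tendsto_of_tendsto_of_le_of_le' tendsto_const_nhds he ?_ ?_
    · filter_upwards [eventually_ge_atTop 1] with n hn
      exact (caseV S PU PV _ hUS hVS hS (abs_nonneg _) hlam hqu hqv hn (ht n hn).1 (ht n hn).2).1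
    · filter_upwards [eventually_ge_atTop 1] with n hn
      exact (caseV S PU PV _ hUS hVS hS (abs_nonneg _) hlam hqu hqv hn (ht n hn).1 (ht n hn).2).2
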